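/- Let n be a natural number and α ≥ 0 a real number. Let E be a subset of the Euclidean space ℝⁿ (with the Euclidean metric) such that 0 < H^α(E) < ∞ and Θ^α(E,x) = 1 for H^α-almost every x ∈ E. Then α is a natural number m, and E is m-rectifiable, i.e., there exist countably many Lipschitz maps f_i : A_i → ℝⁿ with A_i ⊆ ℝ^m (Euclidean metric) such that H^m(E \ ⋃_i f_i(A_i)) = 0. -/

import Mathlib

open MeasureTheory Filter
open scoped ENNReal NNReal

set_option linter.unusedSectionVars false

namespace Dens
open Metric Set Topology

lemma exists_net {X : Type*} [MetricSpace X] [ProperSpace X] (S : Set X)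
    (hS : Bornology.IsBounded S) (s : ℝ) (hs : 0 < s) :
    ∃ A : Finset X, (∀ a ∈ A, a ∈ S) ∧ (∀ a ∈ A, ∀ b ∈ A, a ≠ b → s < dist a b) ∧
      ∀ x ∈ S, ∃ a ∈ A, dist x a ≤ s := by
  lift s to ℝ≥0 using hs.le
  have hs' : 0 < s := by exact_mod_cast hs
  have hfin : packingNumber s S ≠ ⊤ := by
    have h1 := packingNumber_two_mul_le_externalCoveringNumber (s / 2) S
    rw [mul_div_cancel₀ _ (two_ne_zero)] at h1
    obtain ⟨t, ht, hcov⟩ := Metric.totallyBounded_iff.1 (hS.isCompact_closure.totallyBounded.subset subset_closure) (s / 2) (by positivity)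
    have h2 : IsCover (s / 2) S t := by
      intro x hx
      obtain ⟨y, hy, hxy⟩ := mem_iUnion₂.1 (hcov hx)
      refine ⟨y, hy, ?_⟩
      have : dist x y ≤ ((s / 2 : ℝ≥0) : ℝ) := by push_cast; exact (mem_ball.1 hxy).le
      show edist x y ≤ _
      rw [edist_dist]
      exact ENNReal.ofReal_le_of_le_toReal this
    have h3 := h1.trans h2.externalCoveringNumber_le_encard
    intro h
    rw [h] at h3
    exact absurd (ht.encard_lt_top) (by simpa using h3)
  have hF : (maximalSeparatedSet s S).Finite := by
    rw [← encard_ne_top_iff, encard_maximalSeparatedSet hfin]; exact hfin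
  refine ⟨hF.toFinset, ?_, ?_, ?_⟩
  · intro a ha
    exact maximalSeparatedSet_subset (by simpa using ha)
  · intro a ha b hb hab
    have := isSeparated_maximalSeparatedSet (ε := s) (A := S) (by simpa using ha) (by simpa using hb) hab
    have this : (s : ℝ≥0∞) < edist a b := this
    rw [edist_dist] at this
    have h := (ENNReal.lt_ofReal_iff_toReal_lt (by simp)).1 this
    simpa using h
  · intro x hx
    obtain ⟨y, hy, hxy⟩ := isCover_maximalSeparatedSet hfin hx
    refine ⟨y, by simpa using hy, ?_⟩
    have hxy : edist x y ≤ s := hxy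
    rw [edist_dist] at hxy
    simpa using (ENNReal.ofReal_le_iff_le_toReal (by simp)).1 hxy

variable {X : Type*} [NormedAddCommGroup X] [InnerProductSpace ℝ X] [FiniteDimensional ℝ X]
  [MeasurableSpace X] [BorelSpace X]

/-- Finitely additive uniform limits. -/
structure UM (α : ℝ) (ν : Set X → ℝ≥0∞) (K : Set X) : Prop where
  pos : 0 < α
  mono : ∀ A B, A ⊆ B → ν A ≤ ν B
  add : ∀ A B, Disjoint A B → MeasurableSet B → ν (A ∪ B) = ν A + ν B
  empty : ν ∅ = 0
  null : ∀ v, v ∉ K → ∃ ε > 0, ν (closedBall v ε) = 0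
  zero : (0 : X) ∈ K
  uball : ∀ v ∈ K, ∀ s > 0, ν (closedBall v s) = ENNReal.ofReal ((2 * s) ^ α)
  iso : ∀ v ∈ K, ∀ η > 0, ∀ S d, closedBall v η ⊆ S → 0 < d →
    (∀ p ∈ S, ∀ q ∈ S, dist p q ≤ d) → MeasurableSet S → ν S ≤ ENNReal.ofReal (d ^ α)

namespace UM
variable {α : ℝ} {ν : Set X → ℝ≥0∞} {K : Set X}

lemma union_le (h : UM α ν K) (A B : Set X) (hB : MeasurableSet B) : ν (A ∪ B) ≤ ν A + ν B := by
  have : A ∪ B = (A \ B) ∪ B := by simp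
  rw [this, h.add _ _ disjoint_sdiff_left hB]
  gcongr
  exact h.mono _ _ sdiff_subset

lemma biUnion_le (h : UM α ν K) {ι : Type*} (A : Finset ι) (f : ι → Set X)
    (hf : ∀ i, MeasurableSet (f i)) : ν (⋃ i ∈ A, f i) ≤ ∑ i ∈ A, ν (f i) := by
  classical
  induction A using Finset.induction_on with
  | empty => simp [h.empty]
  | insert a A ha ih =>
    rw [Finset.set_biUnion_insert, union_comm, Finset.sum_insert ha, add_comm]
    exact (h.union_le _ _ (hf a)).trans (by gcongr)

lemma biUnion_eq (h : UM α ν K) {ι : Type*} (A : Finset ι) (f : ι → Set X)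
    (hf : ∀ i, MeasurableSet (f i)) (hd : (A : Set ι).PairwiseDisjoint f) :
    ν (⋃ i ∈ A, f i) = ∑ i ∈ A, ν (f i) := by
  classical
  induction A using Finset.induction_on with
  | empty => simp [h.empty]
  | insert a A ha ih =>
    rw [Finset.set_biUnion_insert, union_comm, Finset.sum_insert ha, add_comm, h.add _ _ _ (hf a),
      ih (hd.subset (by simp))]
    rw [disjoint_iUnion₂_left]
    intro i hi
    exact hd (by simp [hi]) (by simp) (by rintro rfl; exact ha hi)

lemma isClosed (h : UM α ν K) : IsClosed K := by
  rw [← isOpen_compl_iff, Metric.isOpen_iff]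
  intro v hv
  obtain ⟨ε, hε, h0⟩ := h.null v hv
  refine ⟨ε, hε, fun w hw hwK => ?_⟩
  have hw' : dist w v < ε := hw
  have h1 := h.uball w hwK (ε - dist w v) (by linarith)
  have h2 : ν (closedBall w (ε - dist w v)) ≤ ν (closedBall v ε) :=
    h.mono _ _ (closedBall_subset_closedBall' (by linarith))
  rw [h1, h0] at h2
  have : (0 : ℝ) < (2 * (ε - dist w v)) ^ α := Real.rpow_pos_of_pos (by linarith) _
  have := ENNReal.ofReal_pos.2 this
  exact absurd h2 (not_le.2 this)

lemma compact_null (h : UM α ν K) (C : Set X) (hC : IsCompact C) (hd : Disjoint C K) : ν C = 0 := by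
  classical
  have : ∀ v : X, v ∈ C → ∃ ε > 0, ν (closedBall v ε) = 0 := fun v hv =>
    h.null v (disjoint_left.1 hd hv)
  choose! ε hε h0 using this
  obtain ⟨t, ht, hcov⟩ := hC.elim_nhds_subcover (fun v => closedBall v (ε v))
    (fun v hv => closedBall_mem_nhds _ (hε v hv))
  have h1 := (h.mono _ _ hcov).trans (h.biUnion_le t _ fun i => measurableSet_closedBall)
  rw [Finset.sum_eq_zero (fun i hi => h0 i (ht i hi))] at h1
  simpa using h1

lemma sym (h : UM α ν K) {u v : X} (hu : u ∈ K) (hv : v ∈ K) : (2 : ℝ) • u - v ∈ K := by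
  by_contra hw
  set w := (2 : ℝ) • u - v with hwdef
  obtain ⟨ε, hε, h0⟩ := h.null w hw
  set r := dist v u with hr
  have huv : v ≠ u := by
    rintro rfl
    apply hw
    rw [hwdef, two_smul, add_sub_cancel_right]; exact hu
  have hrpos : 0 < r := dist_pos.2 huv
  -- choice of δ
  obtain ⟨δ, hδ, hδ1, hδ2⟩ : ∃ δ > 0, δ < r / 4 ∧ 8 * r * δ ≤ ε ^ 2 := by
    refine ⟨min (r / 8) (ε ^ 2 / (8 * r)), by positivity, ?_, ?_⟩
    · exact (min_le_left _ _).trans_lt (by linarith)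
    · calc 8 * r * min (r / 8) (ε ^ 2 / (8 * r)) ≤ 8 * r * (ε ^ 2 / (8 * r)) := by
            gcongr; exact min_le_right _ _
        _ = ε ^ 2 := by field_simp
  set r' := r - δ / 2 with hr'
  set S1 := closedBall u r' \ closedBall w ε with hS1
  set S2 := closedBall v (δ / 4) with hS2
  have hm1 : MeasurableSet S1 := measurableSet_closedBall.diff measurableSet_closedBall
  have hdisj : Disjoint S1 S2 := by
    rw [disjoint_left]
    intro p hp hp2
    have h1 : dist p u ≤ r' := hp.1
    have h2 : dist p v ≤ δ / 4 := hp2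
    have h3 := dist_triangle v p u
    rw [dist_comm v p] at h3
    linarith
  have hwu : dist w u = r := by
    rw [hr, dist_eq_norm, dist_eq_norm, hwdef, two_smul, ← norm_neg]; congr 1; abel
  have hν1 : ν S1 = ENNReal.ofReal ((2 * r') ^ α) := by
    rw [← h.uball u hu r' (by linarith)]
    apply le_antisymm (h.mono _ _ sdiff_subset)
    have : closedBall u r' ⊆ S1 ∪ closedBall w ε := by simp [hS1]
    have := (h.mono _ _ this).trans (h.union_le _ _ measurableSet_closedBall)
    rwa [h0, add_zero] at this
  have hfar : ∀ p ∈ S1, dist p v ≤ 2 * r - 2 * δ := by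
    intro p hp
    have h1 : dist p u ≤ r' := hp.1
    have h2 : ε < dist p w := by simpa using hp.2
    have hpar := parallelogram_law_with_norm ℝ (p - u) (v - u)
    have e1 : p - u + (v - u) = p - w := by rw [hwdef, two_smul]; abel
    have e2 : p - u - (v - u) = p - v := by abel
    rw [e1, e2, ← dist_eq_norm, ← dist_eq_norm, ← dist_eq_norm, ← dist_eq_norm, ← hr] at hpar
    have h3 : dist p u * dist p u ≤ r * r := by
      have : dist p u ≤ r := by linarith
      gcongr
    have h4 : ε ^ 2 ≤ dist p w * dist p w := by nlinarith
    refine (le_abs_self _).trans (abs_le_of_sq_le_sq ?_ (by linarith))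
    nlinarith [sq_nonneg δ]
  have hiso := h.iso v hv (δ / 4) (by linarith) (S1 ∪ S2) (2 * r') subset_union_right (by linarith) (by
    rintro p (hp | hp) q (hq | hq)
    · have h1 : dist p u ≤ r' := hp.1
      have h2 : dist q u ≤ r' := hq.1
      have := dist_triangle_right p q u
      linarith
    · have h1 := hfar p hp
      have h2 : dist q v ≤ δ / 4 := hq
      have := dist_triangle_right p q v
      linarith
    · have h1 := hfar q hq
      have h2 : dist p v ≤ δ / 4 := hp
      have := dist_triangle_right p q v
      linarith
    · have h1 : dist q v ≤ δ / 4 := hq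
      have h2 : dist p v ≤ δ / 4 := hp
      have := dist_triangle_right p q v
      linarith) (hm1.union measurableSet_closedBall)
  rw [h.add _ _ hdisj measurableSet_closedBall, hν1, h.uball v hv _ (by linarith)] at hiso
  have hp : (0 : ℝ) < (2 * (δ / 4)) ^ α := Real.rpow_pos_of_pos (by linarith) _
  have hp' : (0 : ℝ) < (2 * r') ^ α := Real.rpow_pos_of_pos (by linarith) _
  rw [← ENNReal.ofReal_add hp'.le hp.le, ENNReal.ofReal_le_ofReal_iff hp'.le] at hiso
  linarith

end UM

namespace UM
variable {α : ℝ} {ν : Set X → ℝ≥0∞} {K : Set X}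

lemma net (h : UM α ν K) (R s : ℝ) (hR : 0 < R) (hs : 0 < s) :
    ∃ A : Finset X, (∀ a ∈ A, a ∈ K ∧ a ∈ closedBall (0 : X) R) ∧
      (∀ a ∈ A, ∀ b ∈ A, a ≠ b → s < dist a b) ∧
      (∀ x ∈ K ∩ closedBall (0 : X) R, ∃ a ∈ A, dist x a ≤ s) ∧
      (2 * R) ^ α ≤ A.card * (4 * s) ^ α ∧ A.card * s ^ α ≤ (2 * (R + s)) ^ α := by
  obtain ⟨A, hA, hsep, hcov⟩ := exists_net (K ∩ closedBall (0 : X) R)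
    (isBounded_closedBall.subset inter_subset_right) s hs
  refine ⟨A, hA, hsep, hcov, ?_, ?_⟩
  · have hsub : closedBall (0 : X) R ⊆ (closedBall (0 : X) R \ ⋃ a ∈ A, ball a (2 * s)) ∪
        ⋃ a ∈ A, closedBall a (2 * s) := by
      intro x hx
      by_cases hx' : x ∈ ⋃ a ∈ A, ball a (2 * s)
      · right
        exact (iUnion₂_mono fun a _ => ball_subset_closedBall) hx'
      · left; exact ⟨hx, hx'⟩
    have hnull : ν (closedBall (0 : X) R \ ⋃ a ∈ A, ball a (2 * s)) = 0 := by
      apply h.compact_null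
      · exact (isCompact_closedBall (0:X) R).diff (isOpen_biUnion fun _ _ => isOpen_ball)
      · rw [disjoint_left]
        rintro x ⟨hx1, hx2⟩ hxK
        obtain ⟨a, ha, hxa⟩ := hcov x ⟨hxK, hx1⟩
        exact hx2 (mem_iUnion₂.2 ⟨a, ha, by rw [mem_ball]; linarith⟩)
    have h1 := (h.mono _ _ hsub).trans (h.union_le _ _
      (Finset.measurableSet_biUnion _ fun _ _ => measurableSet_closedBall))
    rw [hnull, zero_add] at h1
    have h2 := h1.trans (h.biUnion_le A _ fun _ => measurableSet_closedBall)
    rw [h.uball 0 h.zero R hR, Finset.sum_congr rfl (fun a ha => h.uball a (hA a ha).1 (2 * s) (by linarith)),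
      Finset.sum_const, nsmul_eq_mul] at h2
    have e : 2 * (2 * s) = 4 * s := by ring
    rw [e] at h2
    have h3 : ENNReal.ofReal ((2 * R) ^ α) ≤ ENNReal.ofReal (A.card * (4 * s) ^ α) := by
      rw [ENNReal.ofReal_mul (by positivity)]; simpa using h2
    exact (ENNReal.ofReal_le_ofReal_iff (by positivity)).1 h3
  · have hd : (A : Set X).PairwiseDisjoint fun a => closedBall a (s / 2) := by
      intro a ha b hb hab
      apply closedBall_disjoint_closedBall
      linarith [hsep a ha b hb hab]
    have hsub : (⋃ a ∈ A, closedBall a (s / 2)) ⊆ closedBall (0 : X) (R + s) := by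
      refine iUnion₂_subset fun a ha => closedBall_subset_closedBall' ?_
      have : dist a 0 ≤ R := (hA a ha).2
      linarith
    have h1 := h.mono _ _ hsub
    rw [h.biUnion_eq A _ (fun _ => measurableSet_closedBall) hd, h.uball 0 h.zero _ (by linarith),
      Finset.sum_congr rfl (fun a ha => h.uball a (hA a ha).1 (s / 2) (by linarith)),
      Finset.sum_const, nsmul_eq_mul] at h1
    have e : 2 * (s / 2) = s := by ring
    rw [e] at h1
    have h3 : ENNReal.ofReal (A.card * s ^ α) ≤ ENNReal.ofReal ((2 * (R + s)) ^ α) := by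
      rw [ENNReal.ofReal_mul (by positivity)]; simpa using h1
    exact (ENNReal.ofReal_le_ofReal_iff (by positivity)).1 h3

lemma neg_mem (h : UM α ν K) {u : X} (hu : u ∈ K) : -u ∈ K := by
  simpa using h.sym h.zero hu

lemma add_two (h : UM α ν K) {u v : X} (hu : u ∈ K) (hv : v ∈ K) : (2 : ℝ) • u + v ∈ K := by
  simpa using h.sym hu (h.neg_mem hv)

/-- The translation group of `K`. -/
def grp (K : Set X) : AddSubgroup X where
  carrier := {g | ∀ x ∈ K, g + x ∈ K ∧ -g + x ∈ K}
  zero_mem' := by intro x hx; simpa using hx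
  add_mem' := by
    intro a b ha hb x hx
    refine ⟨?_, ?_⟩
    · rw [add_assoc]; exact (ha _ (hb x hx).1).1
    · have := (ha _ (hb x hx).2).2
      convert this using 1; abel
  neg_mem' := by
    intro a ha x hx
    exact ⟨(ha x hx).2, by simpa using (ha x hx).1⟩

lemma two_mem_grp (h : UM α ν K) {u : X} (hu : u ∈ K) : (2 : ℝ) • u ∈ grp K := by
  intro x hx
  refine ⟨h.add_two hu hx, ?_⟩
  have := h.add_two (h.neg_mem hu) hx
  simpa using this

lemma grp_sub (h : UM α ν K) {g : X} (hg : g ∈ grp K) : g ∈ K := by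
  simpa using (hg 0 h.zero).1

lemma cocompact (h : UM α ν K) : ∃ C > 0, ∀ v ∈ Submodule.span ℝ K, ∃ w ∈ K, dist v w ≤ C := by
  classical
  obtain ⟨b, hbK, hspan, hlin⟩ := exists_linearIndependent ℝ K
  have hfin : b.Finite := hlin.setFinite
  let B : Finset X := hfin.toFinset
  refine ⟨(∑ e ∈ B, ‖e‖) + 1, by positivity, fun v hv => ?_⟩
  rw [← hspan] at hv
  have hv' : v ∈ Submodule.span ℝ (B : Set X) := by simpa [B] using hv
  obtain ⟨f, -, hf⟩ := Submodule.mem_span_finset.1 hv'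
  refine ⟨∑ e ∈ B, ((round (f e / 2) : ℤ)) • ((2 : ℝ) • e), ?_, ?_⟩
  · apply h.grp_sub
    refine AddSubgroup.sum_mem _ fun e he => AddSubgroup.zsmul_mem _ (h.two_mem_grp ?_) _
    exact hbK (by simpa [B] using he)
  · rw [← hf, dist_eq_norm, ← Finset.sum_sub_distrib]
    have : ∀ e ∈ B, ‖f e • e - (round (f e / 2) : ℤ) • ((2 : ℝ) • e)‖ ≤ ‖e‖ := by
      intro e _
      have e1 : f e • e - (round (f e / 2) : ℤ) • ((2 : ℝ) • e) =
          (2 * (f e / 2 - round (f e / 2))) • e := by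
        rw [← Int.cast_smul_eq_zsmul ℝ, smul_smul, ← sub_smul]; congr 1; ring
      rw [e1, norm_smul]
      have := abs_sub_round (f e / 2)
      have h2 : ‖2 * (f e / 2 - round (f e / 2))‖ ≤ 1 := by
        rw [Real.norm_eq_abs, abs_mul]; norm_num; linarith
      calc _ ≤ 1 * ‖e‖ := by gcongr
        _ = _ := one_mul _
    calc _ ≤ ∑ e ∈ B, ‖f e • e - (round (f e / 2) : ℤ) • ((2 : ℝ) • e)‖ := norm_sum_le _ _
      _ ≤ ∑ e ∈ B, ‖e‖ := Finset.sum_le_sum this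
      _ ≤ _ := by linarith

/-- packing in Euclidean space -/
lemma card_le_vol {m : ℕ} (A : Finset (EuclideanSpace ℝ (Fin m))) (s : ℝ) (hs : 0 < s)
    (hsep : ∀ a ∈ A, ∀ b ∈ A, a ≠ b → s < dist a b) (T : Set (EuclideanSpace ℝ (Fin m)))
    (hT : ∀ a ∈ A, closedBall a (s / 2) ⊆ T) :
    A.card * ENNReal.ofReal ((s / 2) ^ m) * volume (ball (0 : EuclideanSpace ℝ (Fin m)) 1)
      ≤ volume T := by
  have hd : (A : Set (EuclideanSpace ℝ (Fin m))).PairwiseDisjoint fun a => closedBall a (s / 2) := by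
    intro a ha b hb hab
    apply closedBall_disjoint_closedBall
    linarith [hsep a ha b hb hab]
  calc _ = ∑ a ∈ A, volume (closedBall a (s / 2)) := by
        rw [Finset.sum_congr rfl (fun a _ => Measure.addHaar_closedBall volume a (by positivity))]
        simp [mul_assoc]
    _ = volume (⋃ a ∈ A, closedBall a (s / 2)) :=
        (measure_biUnion_finset hd fun _ _ => measurableSet_closedBall).symm
    _ ≤ _ := measure_mono (iUnion₂_subset hT)

lemma ball_vol (m : ℕ) : volume (ball (0 : EuclideanSpace ℝ (Fin m)) 1) ≠ 0 ∧
    volume (ball (0 : EuclideanSpace ℝ (Fin m)) 1) ≠ ⊤ :=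
  ⟨(measure_ball_pos _ _ one_pos).ne', measure_ball_lt_top.ne⟩

lemma dim_ge (h : UM α ν K) {m : ℕ} (A : EuclideanSpace ℝ (Fin m) →ₗᵢ[ℝ] X)
    (hA : ∀ v ∈ K, v ∈ range A) : α ≤ m := by
  classical
  by_contra hlt
  push Not at hlt
  have key : ∀ s : ℝ, 0 < s → s ≤ 1 → 2 ^ α * s ^ m ≤ 4 ^ m * 4 ^ α * s ^ α := by
    intro s hs hs1
    obtain ⟨N, hN, hsep, -, hlow, -⟩ := h.net 1 s one_pos hs
    let N' := N.preimage A (A.injective.injOn)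
    have hcard : N'.card = N.card := by
      rw [← Finset.card_image_of_injective N' A.injective]
      congr 1
      ext x
      simp only [N', Finset.mem_image, Finset.mem_preimage]
      constructor
      · rintro ⟨a, ha, rfl⟩; exact ha
      · intro hx
        obtain ⟨a, rfl⟩ := hA x (hN x hx).1
        exact ⟨a, hx, rfl⟩
    have h1 := card_le_vol N' s hs (by
      intro a ha b hb hab
      rw [← A.dist_map]
      exact hsep _ (by simpa [N'] using ha) _ (by simpa [N'] using hb) (fun h => hab (A.injective h)))
      (closedBall 0 2) (by
        intro a ha
        apply closedBall_subset_closedBall'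
        have := (hN (A a) (by simpa [N'] using ha)).2
        rw [mem_closedBall, dist_zero_right, A.norm_map] at this
        rw [dist_zero_right]
        linarith)
    rw [Measure.addHaar_closedBall _ _ (by norm_num), finrank_euclideanSpace_fin,
      ENNReal.mul_le_mul_iff_left (ball_vol m).1 (ball_vol m).2, hcard] at h1
    have h2 : ENNReal.ofReal (N.card * (s / 2) ^ m) ≤ ENNReal.ofReal (2 ^ m) := by
      rw [ENNReal.ofReal_mul (by positivity)]; simpa using h1
    rw [ENNReal.ofReal_le_ofReal_iff (by positivity)] at h2
    rw [Real.mul_rpow (by norm_num) hs.le] at hlow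
    rw [mul_one] at hlow
    have h3 : (N.card : ℝ) * s ^ m ≤ 4 ^ m := by
      rw [div_pow, mul_div_assoc', div_le_iff₀ (by positivity)] at h2
      calc _ ≤ (2:ℝ) ^ m * 2 ^ m := h2
        _ = 4 ^ m := by rw [← mul_pow]; norm_num
    calc 2 ^ α * s ^ m ≤ (N.card * (4 ^ α * s ^ α)) * s ^ m := by gcongr
      _ = (N.card * s ^ m) * 4 ^ α * s ^ α := by ring
      _ ≤ _ := by gcongr
  have hlim : Tendsto (fun s : ℝ => 4 ^ m * 4 ^ α * s ^ (α - m)) (𝓝[>] 0) (𝓝 0) := by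
    have : Tendsto (fun s : ℝ => s ^ (α - m)) (𝓝[>] 0) (𝓝 (0 ^ (α - m))) :=
      ((Real.continuousAt_rpow_const 0 (α - m) (Or.inr (by linarith))).tendsto).mono_left
        nhdsWithin_le_nhds
    rw [Real.zero_rpow (by linarith)] at this
    simpa using this.const_mul ((4:ℝ) ^ m * 4 ^ α)
  have hev : ∀ᶠ s : ℝ in 𝓝[>] 0, (2:ℝ) ^ α ≤ 4 ^ m * 4 ^ α * s ^ (α - m) := by
    have : ∀ᶠ s : ℝ in 𝓝[>] 0, s < 1 := nhdsWithin_le_nhds (Iio_mem_nhds one_pos)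
    filter_upwards [this, self_mem_nhdsWithin] with s hs1 hs0
    have hs0 : 0 < s := hs0
    have := key s hs0 hs1.le
    rw [Real.rpow_sub hs0, Real.rpow_natCast, mul_div_assoc', le_div_iff₀ (by positivity)]
    exact this
  have := ge_of_tendsto hlim hev
  have : (0:ℝ) < 2 ^ α := by positivity
  linarith

lemma dim_le (h : UM α ν K) {m : ℕ} (A : EuclideanSpace ℝ (Fin m) →ₗᵢ[ℝ] X)
    (hA : ∀ v ∈ K, v ∈ range A) (hA' : ∀ v, A v ∈ Submodule.span ℝ K) : (m : ℝ) ≤ α := by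
  classical
  by_contra hlt
  push Not at hlt
  obtain ⟨C, hC, hco⟩ := h.cocompact
  have key : ∀ R : ℝ, 1 ≤ R → R ^ m ≤ ((1 + C) ^ m * (2 * (2 + C)) ^ α) * R ^ α := by
    intro R hR
    obtain ⟨N, hN, hsep, hcov, -, hup⟩ := h.net (R + C) 1 (by linarith) one_pos
    let N' := N.preimage A (A.injective.injOn)
    have hcard : N'.card ≤ N.card := Finset.card_le_card_of_injOn A (by intro a ha; simpa [N'] using ha)
      A.injective.injOn
    have hsub : closedBall (0 : EuclideanSpace ℝ (Fin m)) R ⊆ ⋃ a ∈ N', closedBall a (1 + C) := by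
      intro v hv
      obtain ⟨w, hw, hvw⟩ := hco _ (hA' v)
      have hv' : ‖v‖ ≤ R := by simpa using hv
      obtain ⟨a, ha, hwa⟩ := hcov w ⟨hw, by
        rw [mem_closedBall, dist_zero_right]
        have := norm_le_norm_add_norm_sub' w (A v)
        rw [A.norm_map, ← dist_eq_norm, dist_comm] at this
        linarith⟩
      obtain ⟨a', rfl⟩ := hA a (hN a ha).1
      refine mem_iUnion₂.2 ⟨a', by simpa [N'] using ha, ?_⟩
      rw [mem_closedBall, ← A.dist_map]
      linarith [dist_triangle (A v) w (A a')]
    have h1 := (measure_mono (μ := volume) hsub).trans (measure_biUnion_finset_le _ _)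
    rw [Finset.sum_congr rfl (fun a _ => Measure.addHaar_closedBall volume a (by positivity)),
      Measure.addHaar_closedBall _ _ (by linarith), Finset.sum_const, nsmul_eq_mul, ← mul_assoc,
      finrank_euclideanSpace_fin,
      ENNReal.mul_le_mul_iff_left (ball_vol m).1 (ball_vol m).2] at h1
    have h2 : ENNReal.ofReal (R ^ m) ≤ ENNReal.ofReal (N'.card * (1 + C) ^ m) := by
      rw [ENNReal.ofReal_mul (by positivity)]; simpa using h1
    rw [ENNReal.ofReal_le_ofReal_iff (by positivity)] at h2
    rw [Real.one_rpow, mul_one] at hup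
    have hc : (N'.card : ℝ) ≤ N.card := by exact_mod_cast hcard
    have h3 : (2 * (R + C + 1)) ^ α ≤ ((2 * (2 + C)) * R) ^ α := by
      apply Real.rpow_le_rpow (by positivity) _ h.pos.le
      nlinarith
    rw [Real.mul_rpow (x := 2 * (2 + C)) (y := R) (by positivity) (by positivity)] at h3
    calc R ^ m ≤ N'.card * (1 + C) ^ m := h2
      _ ≤ ((2 * (2 + C)) ^ α * R ^ α) * (1 + C) ^ m := by gcongr; linarith
      _ = _ := by ring
  have hlim : Tendsto (fun R : ℝ => R ^ ((m:ℝ) - α)) atTop atTop :=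
    tendsto_rpow_atTop (by linarith)
  obtain ⟨R, hR1, hR⟩ := ((hlim.eventually_gt_atTop ((1 + C) ^ m * (2 * (2 + C)) ^ α)).and
    (eventually_ge_atTop 1)).exists
  have := key R hR
  rw [Real.rpow_sub (by linarith), Real.rpow_natCast, lt_div_iff₀ (by positivity)] at hR1
  linarith

lemma vol_pos (h : UM α ν K) {m : ℕ} (hm : α = m) (A : EuclideanSpace ℝ (Fin m) →ₗᵢ[ℝ] X)
    (hA : ∀ v ∈ K, v ∈ range A) : 0 < volume (A ⁻¹' K) := by
  classical
  set K' := A ⁻¹' K ∩ closedBall 0 1 with hK'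
  have hcl : IsClosed (A ⁻¹' K) := h.isClosed.preimage A.continuous
  have hcomp : IsCompact K' := (isCompact_closedBall _ _).inter_left hcl
  have hlim := tendsto_measure_cthickening_of_isCompact (μ := volume) hcomp
  have key : ∀ s : ℝ, 0 < s → ENNReal.ofReal ((1 / 4) ^ m) * volume (ball (0 : EuclideanSpace ℝ (Fin m)) 1)
      ≤ volume (cthickening s K') := by
    intro s hs
    obtain ⟨N, hN, hsep, -, hlow, -⟩ := h.net 1 s one_pos hs
    let N' := N.preimage A (A.injective.injOn)
    have hcard : N'.card = N.card := by
      rw [← Finset.card_image_of_injective N' A.injective]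
      congr 1
      ext x
      simp only [N', Finset.mem_image, Finset.mem_preimage]
      constructor
      · rintro ⟨a, ha, rfl⟩; exact ha
      · intro hx
        obtain ⟨a, rfl⟩ := hA x (hN x hx).1
        exact ⟨a, hx, rfl⟩
    have h1 := card_le_vol N' s hs (by
      intro a ha b hb hab
      rw [← A.dist_map]
      exact hsep _ (by simpa [N'] using ha) _ (by simpa [N'] using hb) (fun h => hab (A.injective h)))
      (cthickening s K') (by
        intro a ha x hx
        have ha' := hN (A a) (by simpa [N'] using ha)
        apply mem_cthickening_of_dist_le x a s K'
        · refine ⟨ha'.1, ?_⟩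
          simpa using ha'.2
        · have : dist x a ≤ s / 2 := hx
          linarith)
    refine le_trans ?_ h1
    gcongr
    rw [hcard]
    have : ENNReal.ofReal ((1 / 4) ^ m) ≤ ENNReal.ofReal (N.card * (s / 2) ^ m) := by
      apply ENNReal.ofReal_le_ofReal
      rw [hm, Real.rpow_natCast, Real.rpow_natCast, mul_one] at hlow
      calc (1 / 4 : ℝ) ^ m = 2 ^ m * (1 / 8) ^ m := by rw [← mul_pow]; norm_num
        _ ≤ (N.card * (4 * s) ^ m) * (1 / 8) ^ m := by gcongr
        _ = _ := by rw [mul_assoc, ← mul_pow]; congr 2; ring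
    rw [ENNReal.ofReal_mul (by positivity)] at this
    simpa using this
  have hge : ENNReal.ofReal ((1 / 4) ^ m) * volume (ball (0 : EuclideanSpace ℝ (Fin m)) 1)
      ≤ volume K' := by
    apply ge_of_tendsto (hlim.mono_left (nhdsWithin_le_nhds (s := Ioi 0)))
    filter_upwards [self_mem_nhdsWithin] with s hs using key s hs
  have h0 : 0 < ENNReal.ofReal ((1 / 4) ^ m) * volume (ball (0 : EuclideanSpace ℝ (Fin m)) 1) :=
    ENNReal.mul_pos (by simp) (ball_vol m).1
  exact (h0.trans_le hge).trans_le (measure_mono inter_subset_left)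

theorem flat (h : UM α ν K) : ∃ m : ℕ, α = m ∧ ∃ A : EuclideanSpace ℝ (Fin m) →ₗᵢ[ℝ] X,
    K = range A := by
  set V := Submodule.span ℝ K with hV
  set m := Module.finrank ℝ V with hmdef
  let A : EuclideanSpace ℝ (Fin m) →ₗᵢ[ℝ] X :=
    V.subtypeₗᵢ.comp (stdOrthonormalBasis ℝ V).repr.symm.toLinearIsometry
  have hA' : ∀ v, A v ∈ V := fun v => by simp [A]
  have hA : ∀ v ∈ V, v ∈ range A := fun v hv =>
    ⟨(stdOrthonormalBasis ℝ V).repr ⟨v, hv⟩, by simp [A]⟩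
  have hAK : ∀ v ∈ K, v ∈ range A := fun v hv => hA v (Submodule.subset_span hv)
  have hm : α = m := le_antisymm (h.dim_ge A hAK) (h.dim_le A hAK hA')
  refine ⟨m, hm, A, Subset.antisymm hAK ?_⟩
  have hcl : IsClosed (A ⁻¹' K) := h.isClosed.preimage A.continuous
  have hst := Measure.sub_mem_nhds_zero_of_addHaar_pos volume (A ⁻¹' K) hcl.measurableSet
    (h.vol_pos hm A hAK)
  obtain ⟨ε, hε, hball⟩ := Metric.mem_nhds_iff.1 hst
  rintro _ ⟨v, rfl⟩
  apply h.grp_sub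
  obtain ⟨k, hk⟩ := exists_nat_gt (‖v‖ / ε)
  have hk0 : (0:ℝ) < k := lt_of_le_of_lt (by positivity) hk
  have hmem : ((2 * k : ℝ)⁻¹) • v ∈ ball (0 : EuclideanSpace ℝ (Fin m)) ε := by
    rw [mem_ball, dist_zero_right, norm_smul, norm_inv, Real.norm_of_nonneg (by positivity)]
    rw [div_lt_iff₀ hε] at hk
    rw [inv_mul_lt_iff₀ (by positivity)]
    nlinarith
  obtain ⟨a, ha, b, hb, hab⟩ := Set.mem_sub.1 (hball hmem)
  have h2 : (2 : ℝ) • A a - (2 : ℝ) • A b ∈ grp K :=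
    AddSubgroup.sub_mem _ (h.two_mem_grp ha) (h.two_mem_grp hb)
  have h3 := AddSubgroup.nsmul_mem _ h2 k
  convert h3 using 1
  rw [← smul_sub, ← map_sub, hab, map_smul, ← Nat.cast_smul_eq_nsmul ℝ, smul_smul, smul_smul]
  rw [show (k : ℝ) * 2 * (2 * (k:ℝ))⁻¹ = 1 by field_simp, one_smul]

end UM

lemma dens_bounds (μ : Measure X) {α : ℝ} (hα : 0 < α) {x : X}
    (h : Tendsto (fun r : ℝ => μ (closedBall x r) / ENNReal.ofReal (2 * r) ^ α) (𝓝[>] 0) (𝓝 1))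
    {ε : ℝ} (hε : 0 < ε) : ∃ ρ > 0, ∀ r, 0 < r → r < ρ →
      ENNReal.ofReal ((1 - ε) * (2 * r) ^ α) ≤ μ (closedBall x r) ∧
      μ (closedBall x r) ≤ ENNReal.ofReal ((1 + ε) * (2 * r) ^ α) := by
  have h1 : ∀ᶠ y in 𝓝 (1 : ℝ≥0∞), ENNReal.ofReal (1 - ε) < y ∧ y < ENNReal.ofReal (1 + ε) := by
    apply Ioo_mem_nhds
    · rw [ENNReal.ofReal_lt_one]; linarith
    · rw [ENNReal.one_lt_ofReal]; linarith
  have h2 := h.eventually h1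
  rw [eventually_nhdsWithin_iff, Metric.eventually_nhds_iff] at h2
  obtain ⟨ρ, hρ, h3⟩ := h2
  refine ⟨ρ, hρ, fun r hr hr' => ?_⟩
  have h4 := h3 (y := r) (by rw [dist_zero_right, Real.norm_of_nonneg hr.le]; exact hr') hr
  have e : ENNReal.ofReal (2 * r) ^ α = ENNReal.ofReal ((2 * r) ^ α) :=
    ENNReal.ofReal_rpow_of_pos (by linarith)
  rw [e] at h4
  have p : 0 < (2 * r) ^ α := by positivity
  have p1 : ENNReal.ofReal ((2 * r) ^ α) ≠ 0 := by simpa using p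
  rw [ENNReal.lt_div_iff_mul_lt (Or.inl p1) (Or.inl ENNReal.ofReal_ne_top),
    ENNReal.div_lt_iff (Or.inl p1) (Or.inl ENNReal.ofReal_ne_top),
    ← ENNReal.ofReal_mul' p.le, ← ENNReal.ofReal_mul' p.le] at h4
  exact ⟨h4.1.le, h4.2.le⟩

lemma upper_dens {α : ℝ} (hα : 0 < α) {E : Set X} (hE : MeasurableSet E)
    (hfin : μH[α] E ≠ ⊤)
    (hd : ∀ᵐ x ∂(μH[α].restrict E), Tendsto (fun r : ℝ => (μH[α].restrict E) (closedBall x r)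
      / ENNReal.ofReal (2 * r) ^ α) (𝓝[>] 0) (𝓝 1)) {c : ℝ} (hc : 1 < c) :
    ∀ᵐ x ∂(μH[α].restrict E), ∃ ρ > 0, ∀ S : Set X, x ∈ S → ediam S ≤ ENNReal.ofReal ρ →
      (μH[α].restrict E) S ≤ ENNReal.ofReal c * ediam S ^ α := by
  set μ := (μH[α] : Measure X).restrict E with hμ
  haveI : IsFiniteMeasure μ := ⟨by rw [hμ, Measure.restrict_apply_univ]; exact hfin.lt_top⟩
  set Z : Set X := {x | x ∈ E ∧ Tendsto (fun r : ℝ => μ (closedBall x r)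
      / ENNReal.ofReal (2 * r) ^ α) (𝓝[>] 0) (𝓝 1) ∧ ¬ ∃ ρ > 0, ∀ S : Set X, x ∈ S →
      ediam S ≤ ENNReal.ofReal ρ → μ S ≤ ENNReal.ofReal c * ediam S ^ α} with hZ
  suffices hz : μ Z = 0 by
    have hEae : ∀ᵐ x ∂μ, x ∈ E := ae_restrict_mem hE
    have hz' : ∀ᵐ x ∂μ, x ∉ Z := measure_eq_zero_iff_ae_notMem.1 hz
    filter_upwards [hEae, hd, hz'] with x h1 h2 h3
    by_contra h4
    exact h3 ⟨h1, h2, h4⟩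
  by_contra hz
  have hc0 : ENNReal.ofReal c ≠ 0 := by simpa using (by linarith : 0 < c)
  obtain ⟨O, hZO, hO, hOlt⟩ := Set.exists_isOpen_lt_of_lt (μ := μ) Z (ENNReal.ofReal c * μ Z) (by
    calc μ Z = 1 * μ Z := (one_mul _).symm
      _ < _ := by
        rw [ENNReal.mul_lt_mul_iff_left hz (measure_ne_top _ _)]
        exact ENNReal.one_lt_ofReal.2 hc)
  -- main covering
  have key : ∀ j : ℕ, ∃ u : Set (X × ℝ × Set X), u.Countable ∧
      u.PairwiseDisjoint (fun a => a.2.2) ∧ μ (Z \ ⋃ a ∈ u, a.2.2) = 0 ∧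
      ∀ a ∈ u, IsClosed a.2.2 ∧ a.2.2 ⊆ O ∧ 0 < a.2.1 ∧ a.2.1 ≤ 1 / ((j : ℝ) + 1) ∧
        ediam a.2.2 ≤ ENNReal.ofReal a.2.1 ∧
        ENNReal.ofReal c * ENNReal.ofReal a.2.1 ^ α ≤ μ a.2.2 := by
    intro j
    let C : ℝ := (1 + 1) * 6 ^ α
    have hC : 0 < C := by positivity
    let t : Set (X × ℝ × Set X) := {a | (IsClosed a.2.2 ∧ a.2.2 ⊆ O ∧ 0 < a.2.1 ∧
        a.2.1 ≤ 1 / ((j : ℝ) + 1) ∧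
        ediam a.2.2 ≤ ENNReal.ofReal a.2.1 ∧
        ENNReal.ofReal c * ENNReal.ofReal a.2.1 ^ α ≤ μ a.2.2) ∧ a.2.2 ⊆ closedBall a.1 a.2.1 ∧
        (interior a.2.2).Nonempty ∧ μ (closedBall a.1 (3 * a.2.1)) ≤ C.toNNReal * μ a.2.2}
    obtain ⟨u, hut, hu1, hu2, hu3⟩ := Vitali.exists_disjoint_covering_ae μ Z t C.toNNReal
      (fun a => a.2.1) (fun a => a.1) (fun a => a.2.2) (fun a ha => ha.2.1) (fun a ha => ha.2.2.2)
      (fun a ha => ha.2.2.1) (fun a ha => ha.1.1) (by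
        rintro x hxZ ε hε
        obtain ⟨hxE, hxd, hbad⟩ := hxZ
        obtain ⟨ρ1, hρ1, hb⟩ := dens_bounds μ hα hxd one_pos
        obtain ⟨ρ2, hρ2, hball⟩ := Metric.isOpen_iff.1 hO x (hZO ⟨hxE, hxd, hbad⟩)
        push Not at hbad
        let ρ := min (min ε (1 / ((j : ℝ) + 1))) (min (ρ1 / 4) (ρ2 / 2))
        have hρ : 0 < ρ := by positivity
        have r1 : ρ ≤ ε := (min_le_left _ _).trans (min_le_left _ _)
        have r2 : ρ ≤ 1 / ((j : ℝ) + 1) := (min_le_left _ _).trans (min_le_right _ _)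
        have r3 : ρ ≤ ρ1 / 4 := (min_le_right _ _).trans (min_le_left _ _)
        have r4 : ρ ≤ ρ2 / 2 := (min_le_right _ _).trans (min_le_right _ _)
        obtain ⟨S, hxS, hS, hlt⟩ := hbad (ρ / 2) (by positivity)
        have hne : ediam S ≠ ⊤ := ne_top_of_le_ne_top ENNReal.ofReal_ne_top hS
        have hreal : (ediam S).toReal ≤ ρ / 2 := ENNReal.toReal_le_of_le_ofReal (by positivity) hS
        -- choose r
        have hcont : Tendsto (fun r : ℝ => ENNReal.ofReal c * ENNReal.ofReal r ^ α)
            (𝓝[>] (ediam S).toReal) (𝓝 (ENNReal.ofReal c * ediam S ^ α)) := by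
          have h1 : Tendsto (fun r : ℝ => ENNReal.ofReal r) (𝓝[>] (ediam S).toReal) (𝓝 (ediam S)) := by
            have := (ENNReal.continuous_ofReal.tendsto (ediam S).toReal)
            rw [ENNReal.ofReal_toReal hne] at this
            exact this.mono_left nhdsWithin_le_nhds
          exact ENNReal.Tendsto.const_mul (h1.ennrpow_const α) (Or.inr ENNReal.ofReal_ne_top)
        have hev := (hcont.eventually (Iio_mem_nhds hlt)).and
          (Ioo_mem_nhdsGT (show (ediam S).toReal < ρ by linarith))
        obtain ⟨r, hr1, hr2, hr3⟩ := hev.exists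
        have hr1 : ENNReal.ofReal c * ENNReal.ofReal r ^ α < μ S := hr1
        have hr0 : 0 < r := lt_of_le_of_lt ENNReal.toReal_nonneg hr2
        let δ := (r - (ediam S).toReal) / 2
        have hδ : 0 < δ := by simp only [δ]; linarith
        let S' := cthickening δ S
        have hSS' : S ⊆ S' := self_subset_cthickening S
        have hdS' : ediam S' ≤ ENNReal.ofReal r := by
          have h1 := ediam_cthickening_le (s := S) δ.toNNReal
          rw [Real.coe_toNNReal _ hδ.le] at h1
          refine h1.trans ?_
          rw [← ENNReal.ofReal_toReal hne]
          have : (2 : ℝ≥0∞) * (δ.toNNReal : ℝ≥0∞) = ENNReal.ofReal (2 * δ) := by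
            rw [ENNReal.ofReal_mul (by norm_num)]; simp [ENNReal.ofReal]
          rw [this, ← ENNReal.ofReal_add ENNReal.toReal_nonneg (by linarith)]
          apply ENNReal.ofReal_le_ofReal
          simp only [δ]; linarith
        have hsubB : S' ⊆ closedBall x r := by
          intro y hy
          have := (edist_le_ediam_of_mem hy (hSS' hxS)).trans hdS'
          rw [edist_dist] at this
          exact (ENNReal.ofReal_le_ofReal_iff hr0.le).1 this
        have hmS' : ENNReal.ofReal c * ENNReal.ofReal r ^ α ≤ μ S' :=
          hr1.le.trans (measure_mono hSS')
        refine ⟨(x, r, S'), ⟨⟨isClosed_cthickening, ?_, hr0, by simpa using hr3.le.trans r2, hdS', hmS'⟩,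
          hsubB, ?_, ?_⟩, by simpa using hr3.le.trans r1, rfl⟩
        · refine hsubB.trans ((closedBall_subset_ball ?_).trans hball)
          linarith
        · refine ⟨x, ?_⟩
          apply interior_maximal (thickening_subset_cthickening δ S) isOpen_thickening
          exact self_subset_thickening hδ S hxS
        · refine ((hb (3 * r) (by linarith) (by linarith)).2).trans ?_
          have e1 : (1 + 1) * (2 * (3 * r)) ^ α = C * r ^ α := by
            rw [show 2 * (3 * r) = 6 * r by ring, Real.mul_rpow (by norm_num) hr0.le]
            simp only [C]; ring
          rw [e1, ENNReal.ofReal_mul hC.le]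
          change ENNReal.ofReal C * _ ≤ ENNReal.ofReal C * _
          gcongr
          refine le_trans ?_ hmS'
          rw [ENNReal.ofReal_rpow_of_pos hr0]
          have : (1 : ℝ≥0∞) ≤ ENNReal.ofReal c := ENNReal.one_le_ofReal.2 hc.le
          calc _ = 1 * ENNReal.ofReal (r ^ α) := (one_mul _).symm
            _ ≤ _ := by gcongr)
    exact ⟨u, hu1, hu2, hu3, fun a ha => (hut ha).1⟩
  choose u hu1 hu2 hu3 hu4 using key
  set N : Set X := ⋃ j, (Z \ ⋃ a ∈ u j, a.2.2) with hN
  have hN0 : μ N = 0 := measure_iUnion_null hu3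
  have hHN : μH[α] (Z \ N) = μ Z := by
    have h1 : μ (Z \ N) = μ Z := measure_sdiff_null hN0
    rw [← h1, hμ, Measure.restrict_apply' hE]
    congr 1
    ext x; constructor
    · rintro ⟨h, h'⟩; exact ⟨⟨h, h'⟩, h.1⟩
    · rintro h; exact h.1
  have hcount : ∀ j, Countable (u j) := fun j => (hu1 j).to_subtype
  have hsum : ∀ j, ∑' a : u j, ediam a.1.2.2 ^ α ≤ μ O / ENNReal.ofReal c := by
    intro j
    have h1 : ∑' a : u j, μ a.1.2.2 ≤ μ O := by
      rw [← measure_iUnion (μ := μ) (f := fun a : u j => a.1.2.2)]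
      · exact measure_mono (iUnion_subset fun a => (hu4 j a.1 a.2).2.1)
      · intro a b hab
        exact hu2 j a.2 b.2 (fun h => hab (Subtype.ext h))
      · exact fun a => (hu4 j a.1 a.2).1.measurableSet
    rw [ENNReal.le_div_iff_mul_le (Or.inl hc0) (Or.inl ENNReal.ofReal_ne_top), mul_comm,
      ← ENNReal.tsum_mul_left]
    refine le_trans (ENNReal.tsum_le_tsum fun a => ?_) h1
    have := hu4 j a.1 a.2
    refine le_trans ?_ this.2.2.2.2.2
    gcongr
    exact this.2.2.2.2.1
  have hH := Measure.hausdorffMeasure_le_liminf_tsum (ι := fun j => u j) α (Z \ N) (l := atTop)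
    (fun j : ℕ => ENNReal.ofReal (1 / ((j : ℝ) + 1))) (by
      have := ENNReal.tendsto_ofReal (tendsto_one_div_add_atTop_nhds_zero_nat (𝕜 := ℝ))
      simpa using this) (fun j a => a.1.2.2) (Eventually.of_forall fun j a => by
        have := hu4 j a.1 a.2
        exact this.2.2.2.2.1.trans (ENNReal.ofReal_le_ofReal this.2.2.2.1))
      (Eventually.of_forall fun j x hx => by
        by_contra hne
        apply hx.2
        refine mem_iUnion.2 ⟨j, hx.1, fun h => hne ?_⟩
        obtain ⟨a, ha, hxa⟩ := mem_iUnion₂.1 h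
        exact mem_iUnion.2 ⟨⟨a, ha⟩, hxa⟩)
  rw [hHN] at hH
  have h2 : liminf (fun n => ∑' i : u n, ediam i.1.2.2 ^ α) atTop ≤ μ O / ENNReal.ofReal c := by
    refine (liminf_le_liminf (Eventually.of_forall hsum)).trans ?_
    simp
  have h3 := hH.trans h2
  rw [ENNReal.le_div_iff_mul_le (Or.inl hc0) (Or.inl ENNReal.ofReal_ne_top), mul_comm] at h3
  exact absurd hOlt (not_lt.2 h3)

/-- Points with uniform density bounds. -/
def FF (μ : Measure X) (α ε ρ : ℝ) : Set X :=
  {x | (∀ r, 0 < r → r < ρ → ENNReal.ofReal ((1 - ε) * (2 * r) ^ α) ≤ μ (closedBall x r)) ∧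
    ∀ S : Set X, x ∈ S → ediam S ≤ ENNReal.ofReal ρ → μ S ≤ ENNReal.ofReal (1 + ε) * ediam S ^ α}

/-- Good points. -/
def Good (μ : Measure X) (α : ℝ) (x : X) : Prop :=
  ∀ ε > 0, ∃ ρ > 0, x ∈ FF μ α ε ρ ∧
    Tendsto (fun r => μ (FF μ α ε ρ ∩ closedBall x r) / μ (closedBall x r)) (𝓝[>] 0) (𝓝 1)

lemma FF_mono (μ : Measure X) {α ε ε' ρ ρ' : ℝ} (hε : ε ≤ ε') (hρ : ρ' ≤ ρ) :
    FF μ α ε ρ ⊆ FF μ α ε' ρ' := by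
  rintro x ⟨h1, h2⟩
  refine ⟨fun r hr hr' => le_trans ?_ (h1 r hr (hr'.trans_le hρ)), fun S hS hS' =>
    (h2 S hS (hS'.trans (ENNReal.ofReal_le_ofReal hρ))).trans ?_⟩
  · apply ENNReal.ofReal_le_ofReal; gcongr
  · gcongr

lemma ae_good {α : ℝ} (hα : 0 < α) {E : Set X} (hE : MeasurableSet E)
    (hfin : μH[α] E ≠ ⊤)
    (hd : ∀ᵐ x ∂(μH[α].restrict E), Tendsto (fun r : ℝ => (μH[α].restrict E) (closedBall x r)
      / ENNReal.ofReal (2 * r) ^ α) (𝓝[>] 0) (𝓝 1)) :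
    ∀ᵐ x ∂(μH[α].restrict E), Good (μH[α].restrict E) α x := by
  set μ := (μH[α] : Measure X).restrict E with hμ
  have : IsFiniteMeasure μ := ⟨by rw [hμ, Measure.restrict_apply_univ]; exact hfin.lt_top⟩
  have h1 : ∀ᵐ x ∂μ, ∀ i : ℕ, ∃ ρ > 0, ∀ S : Set X, x ∈ S → ediam S ≤ ENNReal.ofReal ρ →
      μ S ≤ ENNReal.ofReal (1 + 1 / ((i : ℝ) + 1)) * ediam S ^ α := by
    rw [ae_all_iff]
    intro i
    exact upper_dens hα hE hfin hd (by have : 0 < 1 / ((i : ℝ) + 1) := by positivity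
                                       linarith)
  have h2 : ∀ᵐ x ∂μ, ∀ i k : ℕ, x ∈ FF μ α (1 / ((i : ℝ) + 1)) (1 / ((k : ℝ) + 1)) →
      Tendsto (fun r => μ (FF μ α (1 / ((i : ℝ) + 1)) (1 / ((k : ℝ) + 1)) ∩ closedBall x r) /
        μ (closedBall x r)) (𝓝[>] 0) (𝓝 1) := by
    rw [ae_all_iff]; intro i
    rw [ae_all_iff]; intro k
    have := Besicovitch.ae_tendsto_measure_inter_div μ (FF μ α (1 / ((i : ℝ) + 1)) (1 / ((k : ℝ) + 1)))
    have h3 := Measure.measure_inter_eq_zero_of_restrict (ae_iff.1 this)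
    rw [ae_iff]
    refine measure_mono_null ?_ h3
    intro x hx
    simp only [mem_ofPred_eq, Classical.not_imp] at hx
    exact ⟨hx.2, hx.1⟩
  filter_upwards [h1, h2, hd] with x hx1 hx2 hx3
  intro ε hε
  obtain ⟨i, hi⟩ := exists_nat_one_div_lt hε
  obtain ⟨ρ1, hρ1, hS⟩ := hx1 i
  obtain ⟨ρ2, hρ2, hB⟩ := dens_bounds μ hα hx3 (ε := 1 / ((i : ℝ) + 1)) (by positivity)
  obtain ⟨k, hk⟩ := exists_nat_one_div_lt (lt_min hρ1 hρ2)
  have hmem : x ∈ FF μ α (1 / ((i : ℝ) + 1)) (1 / ((k : ℝ) + 1)) :=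
    ⟨fun r hr hr' => (hB r hr (hr'.trans (hk.trans_le (min_le_right _ _)))).1,
      fun S hxS hS' => hS S hxS (hS'.trans (ENNReal.ofReal_le_ofReal (hk.le.trans (min_le_left _ _))))⟩
  have hsub := FF_mono μ (α := α) hi.le (le_refl (1 / ((k : ℝ) + 1)))
  refine ⟨1 / ((k : ℝ) + 1), by positivity, hsub hmem, ?_⟩
  have ht := hx2 i k hmem
  refine tendsto_of_tendsto_of_tendsto_of_le_of_le ht tendsto_const_nhds (fun r => ?_) (fun r => ?_)
  · dsimp only
    gcongr
  · dsimp only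
    exact ENNReal.div_le_of_le_mul (by rw [one_mul]; exact measure_mono inter_subset_right)

/-- blow-up map -/
noncomputable def blow (x : X) (r : ℝ) (z : X) : X := r⁻¹ • (z - x)

lemma blow_meas (x : X) (r : ℝ) : Measurable (blow x r) := by
  unfold blow; exact Continuous.measurable (by fun_prop)

lemma blow_ball (x : X) {r : ℝ} (hr : 0 < r) (v : X) (s : ℝ) :
    blow x r ⁻¹' closedBall v s = closedBall (x + r • v) (s * r) := by
  ext z
  simp only [mem_preimage, mem_closedBall, blow, dist_eq_norm]
  have : z - (x + r • v) = r • (r⁻¹ • (z - x) - v) := by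
    rw [smul_sub, smul_smul, mul_inv_cancel₀ hr.ne', one_smul]; abel
  rw [this, norm_smul, Real.norm_of_nonneg hr.le, mul_comm s r]
  exact (mul_le_mul_iff_right₀ hr).symm

/-- tangent set function -/
noncomputable def tng (μ : Measure X) (α : ℝ) (x : X) (U : Ultrafilter ℝ) (A : Set X) : ℝ≥0∞ :=
  (U.map (fun r => μ (blow x r ⁻¹' A) / ENNReal.ofReal (r ^ α))).lim

lemma tng_tendsto (μ : Measure X) (α : ℝ) (x : X) (U : Ultrafilter ℝ) (A : Set X) :
    Tendsto (fun r => μ (blow x r ⁻¹' A) / ENNReal.ofReal (r ^ α)) U (𝓝 (tng μ α x U A)) :=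
  Ultrafilter.le_nhds_lim (U.map (fun r => μ (blow x r ⁻¹' A) / ENNReal.ofReal (r ^ α)))

/-- tangent support -/
def tsupp (μ : Measure X) (α : ℝ) (x : X) (U : Ultrafilter ℝ) : Set X :=
  {v | ∀ ε > 0, tng μ α x U (closedBall v ε) ≠ 0}

section
variable (μ : Measure X) [IsFiniteMeasure μ] (α : ℝ) (x : X) (U : Ultrafilter ℝ)

lemma U_pos (hU : (U : Filter ℝ) ≤ 𝓝[>] 0) : ∀ᶠ r in (U : Filter ℝ), 0 < r :=
  hU self_mem_nhdsWithin

lemma U_lt (hU : (U : Filter ℝ) ≤ 𝓝[>] 0) {ρ : ℝ} (hρ : 0 < ρ) : ∀ᶠ r in (U : Filter ℝ), r < ρ :=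
  hU (nhdsWithin_le_nhds (Iio_mem_nhds hρ))

variable {μ α x U}

lemma tng_le (hU : (U : Filter ℝ) ≤ 𝓝[>] 0) {A : Set X} {C : ℝ} (hC : 0 ≤ C)
    (h : ∀ᶠ r in (U : Filter ℝ), μ (blow x r ⁻¹' A) ≤ ENNReal.ofReal (C * r ^ α)) :
    tng μ α x U A ≤ ENNReal.ofReal C := by
  apply le_of_tendsto (tng_tendsto μ α x U A)
  filter_upwards [h, U_pos U hU] with r h1 hr
  apply ENNReal.div_le_of_le_mul
  rwa [← ENNReal.ofReal_mul hC]

lemma le_tng (hU : (U : Filter ℝ) ≤ 𝓝[>] 0) {A : Set X} {C : ℝ}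
    (h : ∀ᶠ r in (U : Filter ℝ), ENNReal.ofReal (C * r ^ α) ≤ μ (blow x r ⁻¹' A)) :
    ENNReal.ofReal C ≤ tng μ α x U A := by
  apply ge_of_tendsto (tng_tendsto μ α x U A)
  filter_upwards [h, U_pos U hU] with r h1 hr
  have p : 0 < r ^ α := by positivity
  rw [ENNReal.le_div_iff_mul_le (Or.inl (by simpa using p)) (Or.inl ENNReal.ofReal_ne_top),
    ← ENNReal.ofReal_mul' p.le]
  exact h1

lemma of_lt_tng (hU : (U : Filter ℝ) ≤ 𝓝[>] 0) {A : Set X} {C : ℝ}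
    (h : ENNReal.ofReal C < tng μ α x U A) :
    ∀ᶠ r in (U : Filter ℝ), ENNReal.ofReal (C * r ^ α) < μ (blow x r ⁻¹' A) := by
  filter_upwards [(tng_tendsto μ α x U A).eventually (Ioi_mem_nhds h), U_pos U hU] with r h1 hr
  have p : 0 < r ^ α := by positivity
  have h1 : ENNReal.ofReal C < μ (blow x r ⁻¹' A) / ENNReal.ofReal (r ^ α) := h1
  rw [ENNReal.lt_div_iff_mul_lt (Or.inl (by simpa using p)) (Or.inl ENNReal.ofReal_ne_top),
    ← ENNReal.ofReal_mul' p.le] at h1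
  exact h1

lemma of_tng_lt (hU : (U : Filter ℝ) ≤ 𝓝[>] 0) {A : Set X} {C : ℝ} 
    (h : tng μ α x U A < ENNReal.ofReal C) :
    ∀ᶠ r in (U : Filter ℝ), μ (blow x r ⁻¹' A) < ENNReal.ofReal (C * r ^ α) := by
  filter_upwards [(tng_tendsto μ α x U A).eventually (Iio_mem_nhds h), U_pos U hU] with r h1 hr
  have p : 0 < r ^ α := by positivity
  have h1 : μ (blow x r ⁻¹' A) / ENNReal.ofReal (r ^ α) < ENNReal.ofReal C := h1
  rw [ENNReal.div_lt_iff (Or.inl (by simpa using p)) (Or.inl ENNReal.ofReal_ne_top),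
    ← ENNReal.ofReal_mul' p.le] at h1
  exact h1

lemma ball_ub (hα : 0 < α) {ε ρ : ℝ} (hε : 0 ≤ 1 + ε) {z : X} (hz : z ∈ FF μ α ε ρ) {t : ℝ} (ht : 0 < t)
    (htρ : 2 * t ≤ ρ) : μ (closedBall z t) ≤ ENNReal.ofReal ((1 + ε) * (2 * t) ^ α) := by
  have hd : ediam (closedBall z t) ≤ ENNReal.ofReal (2 * t) := by
    apply ediam_le
    intro a ha b hb
    rw [edist_dist]
    apply ENNReal.ofReal_le_ofReal
    have h1 : dist a z ≤ t := ha
    have h2 : dist b z ≤ t := hb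
    linarith [dist_triangle_right a b z]
  refine (hz.2 _ (mem_closedBall_self ht.le) (hd.trans (ENNReal.ofReal_le_ofReal htρ))).trans ?_
  rw [ENNReal.ofReal_mul hε, ← ENNReal.ofReal_rpow_of_pos (by positivity)]
  gcongr

lemma exists_near (hα : 0 < α) (hx : Good μ α x) (hU : (U : Filter ℝ) ≤ 𝓝[>] 0) {v : X}
    (hv : v ∈ tsupp μ α x U) {η ε : ℝ} (hη : 0 < η) (hε : 0 < ε) :
    ∃ ρ > 0, ∀ᶠ r in (U : Filter ℝ), ∃ z ∈ FF μ α ε ρ, dist z (x + r • v) ≤ η * r := by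
  obtain ⟨ρ, hρ, hxF, ht⟩ := hx ε hε
  refine ⟨ρ, hρ, ?_⟩
  by_contra hcon
  have hcon : ∀ᶠ r in (U : Filter ℝ), ¬ ∃ z ∈ FF μ α ε ρ, dist z (x + r • v) ≤ η * r :=
    Ultrafilter.eventually_not.2 hcon
  obtain ⟨b, hb0, hb⟩ := exists_between (pos_iff_ne_zero.2 (hv η hη))
  have hbt : b ≠ ⊤ := hb.ne_top
  have hb' : ENNReal.ofReal b.toReal < tng μ α x U (closedBall v η) := by
    rwa [ENNReal.ofReal_toReal hbt]
  have hbp : 0 < b.toReal := ENNReal.toReal_pos hb0.ne' hbt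
  set R := ‖v‖ + η with hR
  have hRp : 0 < R := by positivity
  set C : ℝ := (1 + ε) * (2 * R) ^ α with hC
  have hCp : 0 < C := by positivity
  have hlimR : Tendsto (fun r : ℝ => R * r) (U : Filter ℝ) (𝓝[>] 0) := by
    rw [tendsto_nhdsWithin_iff]
    constructor
    · have : Tendsto (fun r : ℝ => R * r) (𝓝 0) (𝓝 (R * 0)) := (continuous_const.mul continuous_id).tendsto 0
      rw [mul_zero] at this
      exact this.mono_left (hU.trans nhdsWithin_le_nhds)
    · filter_upwards [U_pos U hU] with r hr using mul_pos hRp hr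
  have ht' := ht.comp hlimR
  have hsum : ∀ᶠ r in (U : Filter ℝ), μ (FF μ α ε ρ ∩ closedBall x (R * r)) / μ (closedBall x (R * r))
      + ENNReal.ofReal (b.toReal / C) ≤ 1 := by
    filter_upwards [hcon, of_lt_tng hU hb', U_pos U hU, U_lt U hU (show 0 < ρ / (2 * R) by positivity)]
      with r h1 h2 hr hrρ
    rw [blow_ball x hr] at h2
    have hsub : closedBall (x + r • v) (η * r) ⊆ closedBall x (R * r) := by
      apply closedBall_subset_closedBall'
      rw [dist_eq_norm, add_sub_cancel_left, norm_smul, Real.norm_of_nonneg hr.le, hR]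
      linarith
    have hd : Disjoint (FF μ α ε ρ ∩ closedBall x (R * r)) (closedBall (x + r • v) (η * r)) := by
      rw [disjoint_left]
      rintro z ⟨hz, -⟩ hz'
      exact h1 ⟨z, hz, hz'⟩
    have hle : μ (FF μ α ε ρ ∩ closedBall x (R * r)) + μ (closedBall (x + r • v) (η * r)) ≤
        μ (closedBall x (R * r)) := by
      rw [← measure_union hd measurableSet_closedBall]
      exact measure_mono (union_subset inter_subset_right hsub)
    have hub : μ (closedBall x (R * r)) ≤ ENNReal.ofReal (C * r ^ α) := by
      refine (ball_ub hα (by linarith) hxF (t := R * r) (by positivity) ?_).trans_eq ?_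
      · rw [lt_div_iff₀ (by positivity)] at hrρ; linarith
      · rw [← mul_assoc, Real.mul_rpow (by positivity) hr.le, hC, mul_assoc]
    have hp : 0 < r ^ α := by positivity
    have hB0 : μ (closedBall x (R * r)) ≠ 0 := by
      intro h0
      rw [h0] at hle
      have : μ (closedBall (x + r • v) (η * r)) = 0 := by simpa using (le_add_self.trans hle)
      rw [this] at h2
      exact absurd h2 (by simp)
    have hq : ENNReal.ofReal (b.toReal / C) ≤ μ (closedBall (x + r • v) (η * r)) / μ (closedBall x (R * r)) := by
      rw [ENNReal.le_div_iff_mul_le (Or.inl hB0) (Or.inl (measure_ne_top _ _))]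
      refine le_trans ?_ h2.le
      refine (mul_le_mul_right hub _).trans ?_
      rw [← ENNReal.ofReal_mul (by positivity)]
      apply ENNReal.ofReal_le_ofReal
      apply le_of_eq; field_simp
    refine (add_le_add_right hq _).trans ?_
    rw [← ENNReal.add_div]
    exact ENNReal.div_le_of_le_mul (by rw [one_mul]; exact hle)
  have := le_of_tendsto (ht'.add_const (ENNReal.ofReal (b.toReal / C))) hsum
  have hq : 0 < ENNReal.ofReal (b.toReal / C) := by simp; positivity
  have h5 : (1 : ℝ≥0∞) < 1 + ENNReal.ofReal (b.toReal / C) := ENNReal.lt_add_right (by simp) hq.ne'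
  exact absurd this (not_le.2 h5)

lemma tng_UM (hα : 0 < α) (hx : Good μ α x) (hU : (U : Filter ℝ) ≤ 𝓝[>] 0) :
    UM α (tng μ α x U) (tsupp μ α x U) where
  pos := hα
  mono := fun A B hAB => le_of_tendsto_of_tendsto' (tng_tendsto μ α x U A) (tng_tendsto μ α x U B)
    (fun r => by gcongr)
  add := fun A B hd hB => by
    refine tendsto_nhds_unique (tng_tendsto μ α x U (A ∪ B)) ?_
    refine ((tng_tendsto μ α x U A).add (tng_tendsto μ α x U B)).congr (fun r => ?_)
    rw [← ENNReal.add_div, preimage_union, measure_union (hd.preimage _) (blow_meas x r hB)]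
  empty := by
    refine tendsto_nhds_unique (tng_tendsto μ α x U ∅) ?_
    simp
  null := fun v hv => by
    simp only [tsupp, mem_ofPred_eq, not_forall] at hv
    obtain ⟨ε, hε, h⟩ := hv
    exact ⟨ε, hε, not_not.1 h⟩
  zero := by
    intro s hs
    obtain ⟨ρ, hρ, hxF, -⟩ := hx (1 / 2) (by norm_num)
    have : ENNReal.ofReal ((1 - 1 / 2) * (2 * s) ^ α) ≤ tng μ α x U (closedBall 0 s) := by
      apply le_tng hU
      filter_upwards [U_pos U hU, U_lt U hU (show 0 < ρ / s by positivity)] with r hr hr'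
      rw [blow_ball x hr, smul_zero, add_zero]
      refine le_trans (le_of_eq ?_) (hxF.1 (s * r) (by positivity) ?_)
      · rw [← mul_assoc 2 s r, Real.mul_rpow (x := 2 * s) (y := r) (by positivity) hr.le, mul_assoc]
      · rwa [lt_div_iff₀ hs, mul_comm] at hr'
    have p : 0 < ENNReal.ofReal ((1 - 1 / 2) * (2 * s) ^ α) := by
      rw [ENNReal.ofReal_pos]
      have : 0 < (2 * s) ^ α := by positivity
      linarith
    exact (p.trans_le this).ne'
  uball := fun v hv s hs => by
    have hup : ∀ η > 0, tng μ α x U (closedBall v s) ≤ ENNReal.ofReal ((1 + η) * (2 * (s + η)) ^ α) := by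
      intro η hη
      obtain ⟨ρ, hρ, hev⟩ := exists_near hα hx hU hv hη hη
      apply tng_le hU (by positivity)
      filter_upwards [hev, U_pos U hU, U_lt U hU (show 0 < ρ / (2 * (s + η)) by positivity)]
        with r ⟨z, hz, hzr⟩ hr hrρ
      rw [blow_ball x hr]
      have hsub : closedBall (x + r • v) (s * r) ⊆ closedBall z ((s + η) * r) := by
        apply closedBall_subset_closedBall'
        rw [dist_comm]; linarith
      refine (measure_mono hsub).trans ((ball_ub hα (by linarith) hz (by positivity) ?_).trans_eq ?_)
      · rw [lt_div_iff₀ (by positivity)] at hrρ; linarith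
      · rw [← mul_assoc 2, Real.mul_rpow (x := 2 * (s + η)) (by positivity) hr.le, mul_assoc]
    have hlow : ∀ η > 0, η < s → ENNReal.ofReal ((1 - η) * (2 * (s - η)) ^ α) ≤ tng μ α x U (closedBall v s) := by
      intro η hη hηs
      have hsη : 0 < s - η := by linarith
      obtain ⟨ρ, hρ, hev⟩ := exists_near hα hx hU hv hη hη
      apply le_tng hU
      filter_upwards [hev, U_pos U hU, U_lt U hU (show 0 < ρ / (s - η) by positivity)]
        with r ⟨z, hz, hzr⟩ hr hrρ
      rw [blow_ball x hr]
      have hsub : closedBall z ((s - η) * r) ⊆ closedBall (x + r • v) (s * r) := by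
        apply closedBall_subset_closedBall'
        linarith
      refine le_trans (le_of_eq ?_) ((hz.1 ((s - η) * r) (by positivity) ?_).trans (measure_mono hsub))
      · rw [← mul_assoc 2, Real.mul_rpow (x := 2 * (s - η)) (by positivity) hr.le, mul_assoc]
      · rw [lt_div_iff₀ (by positivity)] at hrρ; linarith
    have hc1 : Continuous (fun η : ℝ => ENNReal.ofReal ((1 + η) * (2 * (s + η)) ^ α)) := by
      apply ENNReal.continuous_ofReal.comp
      exact (by fun_prop : Continuous fun η : ℝ => 1 + η).mul
        ((by fun_prop : Continuous fun η : ℝ => 2 * (s + η)).rpow_const fun _ => Or.inr hα.le)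
    have hc2 : Continuous (fun η : ℝ => ENNReal.ofReal ((1 - η) * (2 * (s - η)) ^ α)) := by
      apply ENNReal.continuous_ofReal.comp
      exact (by fun_prop : Continuous fun η : ℝ => 1 - η).mul
        ((by fun_prop : Continuous fun η : ℝ => 2 * (s - η)).rpow_const fun _ => Or.inr hα.le)
    have t1 := (hc1.tendsto 0).mono_left (nhdsWithin_le_nhds (s := Ioi 0))
    have t2 := (hc2.tendsto 0).mono_left (nhdsWithin_le_nhds (s := Ioi 0))
    simp only [add_zero, sub_zero, one_mul] at t1 t2
    apply le_antisymm
    · apply ge_of_tendsto t1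
      filter_upwards [self_mem_nhdsWithin] with η hη using hup η hη
    · apply le_of_tendsto t2
      filter_upwards [Ioo_mem_nhdsGT hs] with η hη using hlow η hη.1 hη.2
  iso := fun v hv η hη S d hS hd hdiam hSm => by
    have hup : ∀ ε > 0, tng μ α x U S ≤ ENNReal.ofReal ((1 + ε) * d ^ α) := by
      intro ε hε
      obtain ⟨ρ, hρ, hev⟩ := exists_near hα hx hU hv hη hε
      apply tng_le hU (by positivity)
      filter_upwards [hev, U_pos U hU, U_lt U hU (show 0 < ρ / d by positivity)]
        with r ⟨z, hz, hzr⟩ hr hrρ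
      have hzS : z ∈ blow x r ⁻¹' S := by
        have : z ∈ blow x r ⁻¹' closedBall v η := by rw [blow_ball x hr]; exact hzr
        exact hS this
      have hd' : ediam (blow x r ⁻¹' S) ≤ ENNReal.ofReal (d * r) := by
        apply ediam_le
        intro a ha b hb
        rw [edist_dist]
        apply ENNReal.ofReal_le_ofReal
        have := hdiam _ ha _ hb
        rw [dist_eq_norm] at this ⊢
        unfold blow at this
        rw [← smul_sub, norm_smul, norm_inv, Real.norm_of_nonneg hr.le, inv_mul_le_iff₀ hr] at this
        rw [sub_sub_sub_cancel_right] at this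
        linarith
      refine (hz.2 _ hzS (hd'.trans (ENNReal.ofReal_le_ofReal ?_))).trans ?_
      · rw [lt_div_iff₀ hd] at hrρ; linarith
      · rw [mul_assoc, ← Real.mul_rpow hd.le hr.le, ENNReal.ofReal_mul (by linarith),
          ← ENNReal.ofReal_rpow_of_pos (by positivity)]
        gcongr
    have hc1 : Continuous (fun ε : ℝ => ENNReal.ofReal ((1 + ε) * d ^ α)) := by
      apply ENNReal.continuous_ofReal.comp; fun_prop
    have t1 := (hc1.tendsto 0).mono_left (nhdsWithin_le_nhds (s := Ioi 0))
    simp only [add_zero, one_mul] at t1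
    apply ge_of_tendsto t1
    filter_upwards [self_mem_nhdsWithin] with ε hε using hup ε hε
end

/-- Flatness of `μ` in `closedBall x s`. -/
def Flat (μ : Measure X) (m : ℕ) (κ κ2 : ℝ) (x : X) (s : ℝ) : Prop :=
  ∃ A : EuclideanSpace ℝ (Fin m) →ₗᵢ[ℝ] X,
    (∀ u, ‖u‖ ≤ s → ENNReal.ofReal (1 / 2 * (κ * s) ^ m) ≤ μ (closedBall (x + A u) (κ * s))) ∧
    μ {z | z ∈ closedBall x s ∧ ∀ u, κ * s < dist z (x + A u)} ≤ ENNReal.ofReal (κ2 * s ^ m)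

lemma good_nat (μ : Measure X) [IsFiniteMeasure μ] {α : ℝ} (hα : 0 < α) {x : X} (hx : Good μ α x) :
    ∃ m : ℕ, α = m := by
  obtain ⟨m, hm, -⟩ := (tng_UM hα hx (Ultrafilter.of_le (𝓝[>] (0:ℝ)))).flat
  exact ⟨m, hm⟩

lemma good_flat (μ : Measure X) [IsFiniteMeasure μ] {m : ℕ} (hm : 0 < m) {x : X}
    (hx : Good μ (m : ℝ) x) {κ κ2 : ℝ} (hκ : 0 < κ) (hκ2 : 0 < κ2) :
    ∃ ρ > 0, ∀ s, 0 < s → s < ρ → Flat μ m κ κ2 x s := by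
  classical
  have hα : (0:ℝ) < m := by exact_mod_cast hm
  suffices h : ∀ᶠ s in 𝓝[>] (0:ℝ), Flat μ m κ κ2 x s by
    obtain ⟨ρ, hρ, h'⟩ := (mem_nhdsGT_iff_exists_Ioo_subset.1 h)
    exact ⟨ρ, hρ, fun s h1 h2 => h' ⟨h1, h2⟩⟩
  by_contra hfr
  rw [Filter.not_eventually] at hfr
  have hne : (𝓝[>] (0:ℝ) ⊓ 𝓟 {s | ¬ Flat μ m κ κ2 x s}).NeBot := Filter.frequently_iff_neBot.1 hfr
  set U := Ultrafilter.of (𝓝[>] (0:ℝ) ⊓ 𝓟 {s | ¬ Flat μ m κ κ2 x s}) with hUdef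
  have hUle : (U : Filter ℝ) ≤ 𝓝[>] (0:ℝ) ⊓ 𝓟 {s | ¬ Flat μ m κ κ2 x s} := Ultrafilter.of_le _
  have hU : (U : Filter ℝ) ≤ 𝓝[>] (0:ℝ) := hUle.trans inf_le_left
  have hbad : ∀ᶠ s in (U : Filter ℝ), ¬ Flat μ m κ κ2 x s :=
    (hUle.trans inf_le_right) (mem_principal_self _)
  have hUM := tng_UM hα hx hU
  obtain ⟨m', hm', A, hA⟩ := hUM.flat
  obtain rfl : m = m' := by exact_mod_cast hm'
  obtain ⟨N, hN, -, hcov⟩ := exists_net (closedBall (0 : EuclideanSpace ℝ (Fin m)) 1)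
    isBounded_closedBall (κ / 2) (by positivity)
  have h1 : ∀ᶠ r in (U : Filter ℝ), ∀ a ∈ N, ENNReal.ofReal (1 / 2 * κ ^ m * r ^ (m : ℝ)) <
      μ (blow x r ⁻¹' closedBall (A a) (κ / 2)) := by
    rw [Filter.eventually_all_finset]
    intro a _
    apply of_lt_tng hU
    rw [hUM.uball (A a) (by rw [hA]; exact ⟨a, rfl⟩) _ (by positivity)]
    rw [show 2 * (κ / 2) = κ by ring, Real.rpow_natCast]
    have : 0 < κ ^ m := by positivity
    rw [ENNReal.ofReal_lt_ofReal_iff this]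
    linarith
  set T : Set X := closedBall 0 1 ∩ ⋂ u, {v | κ ≤ dist v (A u)} with hT
  have hTc : IsCompact T := (isCompact_closedBall 0 1).inter_right
    (isClosed_iInter fun u => isClosed_le continuous_const (by fun_prop))
  have hT0 : tng μ m x U T = 0 := by
    apply hUM.compact_null _ hTc
    rw [disjoint_left, hA]
    rintro _ ⟨-, h⟩ ⟨u, rfl⟩
    have := mem_iInter.1 h u
    simp only [mem_ofPred_eq, dist_self] at this
    linarith
  have h2 : ∀ᶠ r in (U : Filter ℝ), μ (blow x r ⁻¹' T) < ENNReal.ofReal (κ2 * r ^ (m : ℝ)) := by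
    apply of_tng_lt hU
    rw [hT0]; simpa using hκ2
  obtain ⟨r, hr1, hr2, hr3, hr⟩ := (h1.and (h2.and (hbad.and (U_pos U hU)))).exists
  apply hr3
  refine ⟨A, fun u hu => ?_, ?_⟩
  · obtain ⟨a, ha, hua⟩ := hcov (r⁻¹ • u) (by
      rw [mem_closedBall, dist_zero_right, norm_smul, norm_inv, Real.norm_of_nonneg hr.le,
        inv_mul_le_iff₀ hr]
      linarith)
    have := (hr1 a ha).le
    rw [blow_ball x hr, Real.rpow_natCast, mul_assoc, ← mul_pow] at this
    refine this.trans (measure_mono (closedBall_subset_closedBall' ?_))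
    have e : dist (x + r • A a) (x + A u) = r * dist (r⁻¹ • u) a := by
      rw [dist_add_left, ← map_smul, A.dist_map, dist_comm, dist_eq_norm, dist_eq_norm]
      have : u - r • a = r • (r⁻¹ • u - a) := by
        rw [smul_sub, smul_smul, mul_inv_cancel₀ hr.ne', one_smul]
      rw [this, norm_smul, Real.norm_of_nonneg hr.le]
    rw [e]
    nlinarith
  · rw [Real.rpow_natCast] at hr2
    refine (measure_mono ?_).trans hr2.le
    rintro z ⟨hz1, hz2⟩
    refine ⟨?_, mem_iInter.2 fun u => ?_⟩
    · rw [mem_closedBall, dist_zero_right]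
      unfold blow
      rw [mem_closedBall, dist_eq_norm] at hz1
      rw [norm_smul, norm_inv, Real.norm_of_nonneg hr.le, inv_mul_le_iff₀ hr]
      linarith
    · have := hz2 (r • u)
      have e : dist z (x + A (r • u)) = r * dist (blow x r z) (A u) := by
        unfold blow
        rw [dist_eq_norm, dist_eq_norm]
        have : z - (x + A (r • u)) = r • (r⁻¹ • (z - x) - A u) := by
          rw [smul_sub, smul_smul, mul_inv_cancel₀ hr.ne', one_smul, map_smul]; abel
        rw [this, norm_smul, Real.norm_of_nonneg hr.le]
      rw [e] at this
      change κ ≤ dist (blow x r z) (A u)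
      by_contra hlt
      push Not at hlt
      nlinarith

/-- Uniformly regular sets. -/
def Reg (μ : Measure X) (m : ℕ) (κ κ2 r1 : ℝ) (T : Set X) : Prop :=
  ∀ y ∈ T, ∀ s, 0 < s → s < r1 → ENNReal.ofReal (s ^ m) ≤ μ (closedBall y s) ∧
    μ (closedBall y s) ≤ ENNReal.ofReal ((4 * s) ^ m) ∧ Flat μ m κ κ2 y s

lemma good_reg (μ : Measure X) [IsFiniteMeasure μ] {m : ℕ} (hm : 0 < m) {x : X}
    (hx : Good μ (m : ℝ) x) {κ κ2 : ℝ} (hκ : 0 < κ) (hκ2 : 0 < κ2) :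
    ∃ ρ > 0, Reg μ m κ κ2 ρ {x} := by
  have hα : (0:ℝ) < m := by exact_mod_cast hm
  obtain ⟨ρ1, h1, hf⟩ := good_flat μ hm hx hκ hκ2
  obtain ⟨ρ2, h2, hxF, -⟩ := hx (1 / 2) (by norm_num)
  refine ⟨min ρ1 (ρ2 / 2), by positivity, ?_⟩
  rintro y rfl s hs hs'
  have hs1 : s < ρ1 := hs'.trans_le (min_le_left _ _)
  have hs2 : s < ρ2 / 2 := hs'.trans_le (min_le_right _ _)
  refine ⟨?_, ?_, hf s hs hs1⟩
  · refine le_trans (ENNReal.ofReal_le_ofReal ?_) (hxF.1 s hs (by linarith))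
    rw [Real.rpow_natCast, mul_pow]
    have : (2:ℝ) ≤ 2 ^ m := by
      calc (2:ℝ) = 2 ^ 1 := by norm_num
        _ ≤ 2 ^ m := by gcongr; norm_num; omega
    have h0 : 0 < s ^ m := by positivity
    nlinarith
  · refine (ball_ub hα (by norm_num) hxF hs (by linarith)).trans (ENNReal.ofReal_le_ofReal ?_)
    rw [Real.rpow_natCast, show 4 * s = 2 * (2 * s) by ring, mul_pow 2 (2 * s)]
    have : (2:ℝ) ≤ 2 ^ m := by
      calc (2:ℝ) = 2 ^ 1 := by norm_num
        _ ≤ 2 ^ m := by gcongr; norm_num; omega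
    gcongr
    linarith

/-- Vitali-type estimate. -/
lemma vitali_est {m : ℕ} (σ : Measure (Fin m → ℝ)) (S W : Set (Fin m → ℝ)) {lam L0 : ℝ}
    (hlam : 0 < lam)
    (h : ∀ t ∈ S, ∃ l, 0 < l ∧ l ≤ L0 ∧ ENNReal.ofReal (lam * l ^ m) ≤ σ (closedBall t l) ∧
      closedBall t l ⊆ W) :
    ENNReal.ofReal lam * volume S ≤ ENNReal.ofReal (10 ^ m) * σ W := by
  choose! l hl0 hl1 hl2 hl3 using h
  obtain ⟨u, hu, hd, hcov⟩ := Vitali.exists_disjoint_subfamily_covering_enlargement_closedBall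
    S (fun t => t) l L0 hl1 5 (by norm_num)
  have hc : u.Countable := hd.countable_of_nonempty_interior fun t ht =>
    (nonempty_ball.2 (hl0 t (hu ht))).mono ball_subset_interior_closedBall
  have hcov' : S ⊆ ⋃ t ∈ u, closedBall t (5 * l t) := by
    intro t ht
    obtain ⟨b, hb, hsub⟩ := hcov t ht
    exact mem_iUnion₂.2 ⟨b, hb, hsub (mem_closedBall_self (hl0 t ht).le)⟩
  have : Countable u := hc.to_subtype
  have h1 : volume S ≤ ∑' t : u, volume (closedBall t.1 (5 * l t.1)) := by
    refine (measure_mono hcov').trans (measure_biUnion_le _ hc _)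
  have h2 : ∑' t : u, σ (closedBall t.1 (l t.1)) ≤ σ W := by
    rw [← measure_biUnion hc hd (fun _ _ => measurableSet_closedBall)]
    exact measure_mono (iUnion₂_subset fun t ht => hl3 t (hu ht))
  calc ENNReal.ofReal lam * volume S
      ≤ ENNReal.ofReal lam * ∑' t : u, volume (closedBall t.1 (5 * l t.1)) := by gcongr
    _ = ∑' t : u, ENNReal.ofReal lam * volume (closedBall t.1 (5 * l t.1)) :=
        ENNReal.tsum_mul_left.symm
    _ ≤ ∑' t : u, ENNReal.ofReal (10 ^ m) * σ (closedBall t.1 (l t.1)) := by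
        refine ENNReal.tsum_le_tsum fun t => ?_
        have p := hl0 t.1 (hu t.2)
        refine le_trans (le_of_eq ?_) (mul_le_mul_right (hl2 t.1 (hu t.2)) _)
        rw [Real.volume_pi_closedBall _ (by linarith), Fintype.card_fin,
          ← ENNReal.ofReal_mul hlam.le, ← ENNReal.ofReal_mul (by positivity)]
        congr 1
        rw [← mul_assoc 2, mul_pow]; norm_num; ring
    _ = ENNReal.ofReal (10 ^ m) * ∑' t : u, σ (closedBall t.1 (l t.1)) := ENNReal.tsum_mul_left
    _ ≤ _ := by gcongr

lemma closed_good {m : ℕ} (σ : Measure (Fin m → ℝ)) (lam L0 : ℝ) :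
    IsClosed {t | ∀ l, 0 < l → l < L0 → σ (closedBall t l) ≤ ENNReal.ofReal (lam * l ^ m)} := by
  rw [← isOpen_compl_iff, Metric.isOpen_iff]
  intro t ht
  simp only [mem_compl_iff, mem_ofPred_eq, not_forall, not_le] at ht
  obtain ⟨l, hl, hl', hlt⟩ := ht
  have hcont : Continuous (fun e : ℝ => ENNReal.ofReal (lam * (l + e) ^ m)) := by
    apply ENNReal.continuous_ofReal.comp; fun_prop
  have h1 := (hcont.tendsto 0).mono_left (nhdsWithin_le_nhds (s := Ioi 0))
  simp only [add_zero] at h1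
  obtain ⟨e, he1, he2, he3⟩ := ((h1.eventually (Iio_mem_nhds hlt)).and
    (Ioo_mem_nhdsGT (show 0 < L0 - l by linarith))).exists
  have he1 : ENNReal.ofReal (lam * (l + e) ^ m) < σ (closedBall t l) := he1
  refine ⟨e, he2, fun t' ht' => ?_⟩
  simp only [mem_compl_iff, mem_ofPred_eq, not_forall, not_le]
  refine ⟨l + e, by linarith, by linarith, he1.trans_le (measure_mono (closedBall_subset_closedBall' ?_))⟩
  rw [dist_comm]
  have : dist t' t < e := ht'
  linarith

lemma nondeg (μ : Measure X) {m J : ℕ} (hJ : 0 < J) {Lam : ℝ} (hLam : 0 ≤ Lam)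
    (hJL : Lam < J * (1 / 2 * (1 / 16) ^ m)) (p : X →ₗ[ℝ] (Fin m → ℝ)) (hp : ∀ z, ‖p z‖ ≤ ‖z‖)
    (A : EuclideanSpace ℝ (Fin m) →ₗᵢ[ℝ] X) {y : X} {l : ℝ} (hl : 0 < l) {t : Fin m → ℝ}
    (ht : dist (p y) t ≤ l / 8) {D : Set X}
    (hA : ∀ u, ‖u‖ ≤ J * l → ENNReal.ofReal (1 / 2 * (l / 16) ^ m) ≤ μ (closedBall (y + A u) (l / 16)))
    (hD : ∀ u, ‖u‖ ≤ J * l → closedBall (y + A u) (l / 16) ⊆ D)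
    (hs : μ (p ⁻¹' closedBall t l ∩ D) ≤ ENNReal.ofReal (Lam * l ^ m)) :
    ∀ u, 1 / (16 * J) * ‖u‖ ≤ ‖p (A u)‖ := by
  intro u
  by_contra hlt
  push Not at hlt
  have hJ' : (0:ℝ) < J := by exact_mod_cast hJ
  have hu : 0 < ‖u‖ := by
    rcases (norm_nonneg u).eq_or_lt with h | h
    · rw [← h, mul_zero] at hlt
      exact absurd hlt (not_lt.2 (norm_nonneg _))
    · exact h
  set v := ‖u‖⁻¹ • u with hv
  have hv1 : ‖v‖ = 1 := by rw [hv, norm_smul, norm_inv, norm_norm, inv_mul_cancel₀ hu.ne']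
  have hpv : ‖p (A v)‖ ≤ 1 / (16 * J) := by
    rw [hv, map_smul, map_smul, norm_smul, norm_inv, norm_norm, inv_mul_le_iff₀ hu]
    linarith
  let w : ℕ → EuclideanSpace ℝ (Fin m) := fun j => ((j : ℝ) * l) • v
  have hw : ∀ j < J, ‖w j‖ ≤ J * l := by
    intro j hj
    simp only [w]
    rw [norm_smul, hv1, mul_one, Real.norm_of_nonneg (by positivity)]
    have : (j:ℝ) ≤ J := by exact_mod_cast hj.le
    gcongr
  have hd : (Finset.range J : Set ℕ).PairwiseDisjoint fun j => closedBall (y + A (w j)) (l / 16) := by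
    intro i _ j _ hij
    apply closedBall_disjoint_closedBall
    rw [dist_add_left, A.dist_map, dist_eq_norm]
    simp only [w]
    rw [← sub_smul, norm_smul, hv1, mul_one, ← sub_mul, norm_mul, Real.norm_of_nonneg hl.le,
      Real.norm_eq_abs]
    have h1 : (1:ℝ) ≤ |(i:ℝ) - j| := by
      have h2 : (1:ℤ) ≤ |(i:ℤ) - j| := Int.one_le_abs (sub_ne_zero.2 (by exact_mod_cast hij))
      exact_mod_cast h2
    nlinarith
  have hsub : (⋃ j ∈ Finset.range J, closedBall (y + A (w j)) (l / 16)) ⊆ p ⁻¹' closedBall t l ∩ D := by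
    refine iUnion₂_subset fun j hj => ?_
    have hj := Finset.mem_range.1 hj
    refine subset_inter (fun z hz => ?_) (hD _ (hw j hj))
    rw [mem_preimage, mem_closedBall]
    have e1 : dist (p z) (p (y + A (w j))) ≤ l / 16 := by
      rw [dist_eq_norm, ← map_sub]
      refine (hp _).trans ?_
      rw [← dist_eq_norm]; exact hz
    have e2 : dist (p (y + A (w j))) (p y) ≤ l / 16 := by
      rw [dist_eq_norm, ← map_sub, add_sub_cancel_left]
      simp only [w]
      rw [map_smul, map_smul, norm_smul, Real.norm_of_nonneg (by positivity)]
      have : (j:ℝ) ≤ J := by exact_mod_cast hj.le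
      calc (j:ℝ) * l * ‖p (A v)‖ ≤ J * l * (1 / (16 * J)) := by gcongr
        _ = l / 16 := by field_simp
    linarith [dist_triangle4 (p z) (p (y + A (w j))) (p y) t]
  have h1 := (measure_mono hsub).trans hs
  rw [measure_biUnion_finset hd (fun _ _ => measurableSet_closedBall)] at h1
  have h2 : ∑ _j ∈ Finset.range J, ENNReal.ofReal (1 / 2 * (l / 16) ^ m) ≤ ENNReal.ofReal (Lam * l ^ m) :=
    (Finset.sum_le_sum fun j hj => hA _ (hw j (Finset.mem_range.1 hj))).trans h1
  rw [Finset.sum_const, Finset.card_range, nsmul_eq_mul, ← ENNReal.ofReal_natCast,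
    ← ENNReal.ofReal_mul (by positivity), ENNReal.ofReal_le_ofReal_iff (by positivity)] at h2
  have h3 : (J:ℝ) * (1 / 2 * (l / 16) ^ m) = (J * (1 / 2 * (1 / 16) ^ m)) * l ^ m := by
    rw [div_eq_mul_one_div l, mul_pow]; ring
  rw [h3] at h2
  have : 0 < l ^ m := by positivity
  nlinarith

lemma solve {m : ℕ} {c : ℝ} (hc : 0 < c) (q : EuclideanSpace ℝ (Fin m) →ₗ[ℝ] (Fin m → ℝ))
    (hq : ∀ u, c * ‖u‖ ≤ ‖q u‖) (v : Fin m → ℝ) : ∃ u, q u = v := by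
  have hinj : Function.Injective q := by
    rw [injective_iff_map_eq_zero]
    intro u hu
    have := hq u
    rw [hu, norm_zero] at this
    have h2 : ‖u‖ ≤ 0 := by
      by_contra h; push Not at h
      have := mul_pos hc h
      linarith
    exact norm_le_zero_iff.1 h2
  exact (LinearMap.injective_iff_surjective_of_finrank_eq_finrank (by simp)).1 hinj v

/-- Data for the projection argument. -/
structure Ctx (μ : Measure X) (m J : ℕ) (Lam L0 r1 : ℝ) (T : Set X)
    (p : X →ₗ[ℝ] (Fin m → ℝ)) (x0 : X) : Prop where
  hm : 0 < m
  hJ : 0 < J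
  hLam : 0 ≤ Lam
  hJL : Lam < J * (1 / 2 * (1 / 16) ^ m)
  hp : ∀ z, ‖p z‖ ≤ ‖z‖
  hL0 : 0 < L0
  hr : 64 * J * L0 < r1
  hx0 : x0 ∈ T
  reg : Reg μ m (1 / (1024 * J)) ((1 / (2048 * J)) ^ m) r1 T

/-- Good points in the target. -/
def NN (μ : Measure X) (m J : ℕ) (Lam L0 : ℝ) (T : Set X)
    (p : X →ₗ[ℝ] (Fin m → ℝ)) (x0 : X) : Set (Fin m → ℝ) :=
  {t | ∀ l, 0 < l → l < L0 →
    μ (p ⁻¹' closedBall t l ∩ closedBall x0 (16 * J * L0)) ≤ ENNReal.ofReal (Lam * l ^ m) ∧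
    μ (p ⁻¹' closedBall t l ∩ (closedBall x0 (16 * J * L0) \ toMeasurable μ T)) ≤
      ENNReal.ofReal ((1 / 4) ^ m * l ^ m)}

namespace Ctx
variable {μ : Measure X} [IsFiniteMeasure μ] {m J : ℕ} {Lam L0 r1 : ℝ} {T : Set X}
    {p : X →ₗ[ℝ] (Fin m → ℝ)} {x0 : X}

lemma plane (h : Ctx μ m J Lam L0 r1 T p x0) {y : X} (hy : y ∈ T)
    (hyx : dist y x0 ≤ 8 * J * L0) {l : ℝ} (hl : 0 < l) (hl' : l < L0) {t : Fin m → ℝ}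
    (ht : t ∈ NN μ m J Lam L0 T p x0) (hpt : dist (p y) t ≤ l / 8) :
    ∃ A : EuclideanSpace ℝ (Fin m) →ₗᵢ[ℝ] X, (∀ u, 1 / (16 * J) * ‖u‖ ≤ ‖p (A u)‖) ∧
      (∀ u, ‖u‖ ≤ 64 * J * l →
        ENNReal.ofReal (1 / 2 * (l / 16) ^ m) ≤ μ (closedBall (y + A u) (l / 16))) ∧
      μ {z | z ∈ closedBall y (64 * J * l) ∧ ∀ u, l / 16 < dist z (y + A u)} ≤
        ENNReal.ofReal ((l / 32) ^ m) := by
  have hJ : (1:ℝ) ≤ J := by exact_mod_cast h.hJ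
  have hL0 := h.hL0
  have hr := h.hr
  obtain ⟨-, -, A, hA1, hA2⟩ := h.reg y hy (64 * J * l) (by positivity) (by nlinarith)
  have e1 : 1 / (1024 * (J:ℝ)) * (64 * J * l) = l / 16 := by field_simp; norm_num
  have e2 : (1 / (2048 * (J:ℝ))) ^ m * (64 * J * l) ^ m = (l / 32) ^ m := by
    rw [← mul_pow]; congr 1; field_simp; norm_num
  rw [e1] at hA1 hA2
  rw [e2] at hA2
  refine ⟨A, ?_, hA1, hA2⟩
  refine nondeg μ h.hJ h.hLam h.hJL p h.hp A hl hpt (D := closedBall x0 (16 * J * L0))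
    (fun u hu => hA1 u (by nlinarith)) (fun u hu => ?_) (ht l hl hl').1
  apply closedBall_subset_closedBall'
  have : dist (y + A u) x0 ≤ ‖u‖ + dist y x0 := by
    rw [dist_eq_norm, dist_eq_norm, ← A.norm_map u, add_sub_right_comm, add_comm]
    exact norm_add_le _ _
  nlinarith

lemma step (h : Ctx μ m J Lam L0 r1 T p x0) {y : X} (hy : y ∈ T)
    (hyx : dist y x0 ≤ 8 * J * L0) {l : ℝ} (hl : 0 < l) (hl' : l < L0) {t : Fin m → ℝ}
    (ht : t ∈ NN μ m J Lam L0 T p x0) (hpt : dist (p y) t ≤ l / 8) :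
    ∃ y' ∈ T, dist (p y') t ≤ l / 16 ∧ dist y' y ≤ 3 * J * l := by
  have hJ : (1:ℝ) ≤ J := by exact_mod_cast h.hJ
  have hL0 := h.hL0
  obtain ⟨A, hA0, hA1, -⟩ := h.plane hy hyx hl hl' ht hpt
  obtain ⟨u, hu⟩ := solve (c := 1 / (16 * (J:ℝ))) (by positivity) (p ∘ₗ A.toLinearMap) hA0 (t - p y)
  have hu' : p (A u) = t - p y := hu
  have hun : ‖u‖ ≤ 2 * J * l := by
    have h1 := hA0 u
    rw [hu', ← dist_eq_norm, dist_comm] at h1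
    have h2 := h1.trans hpt
    rw [one_div, inv_mul_le_iff₀ (by positivity)] at h2
    linarith
  have hpw : p (y + A u) = t := by rw [map_add, hu']; abel
  have hsub : closedBall (y + A u) (l / 16) ⊆ p ⁻¹' closedBall t (l / 16) ∩ closedBall x0 (16 * J * L0) := by
    intro z hz
    constructor
    · rw [mem_preimage, mem_closedBall, ← hpw, dist_eq_norm, ← map_sub]
      refine (h.hp _).trans ?_
      rw [← dist_eq_norm]; exact hz
    · have hz : dist z (y + A u) ≤ l / 16 := hz
      have : dist (y + A u) x0 ≤ ‖u‖ + dist y x0 := by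
        rw [dist_eq_norm, dist_eq_norm, ← A.norm_map u, add_sub_right_comm, add_comm]
        exact norm_add_le _ _
      rw [mem_closedBall]
      have := dist_triangle z (y + A u) x0
      nlinarith
  have hne : (T ∩ closedBall (y + A u) (l / 16)).Nonempty := by
    by_contra hemp
    rw [not_nonempty_iff_eq_empty] at hemp
    have h1 : μ (toMeasurable μ T ∩ closedBall (y + A u) (l / 16)) = 0 := by
      rw [Measure.measure_toMeasurable_inter measurableSet_closedBall (measure_ne_top _ _), hemp,
        measure_empty]
    have h2 := (ht (l / 16) (by positivity) (by linarith)).2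
    have h3 : μ (closedBall (y + A u) (l / 16)) ≤ ENNReal.ofReal ((1 / 4) ^ m * (l / 16) ^ m) := by
      calc _ ≤ μ (toMeasurable μ T ∩ closedBall (y + A u) (l / 16)) +
            μ (p ⁻¹' closedBall t (l / 16) ∩ (closedBall x0 (16 * J * L0) \ toMeasurable μ T)) := by
            refine le_trans (measure_mono ?_) (measure_union_le _ _)
            intro z hz
            by_cases hzT : z ∈ toMeasurable μ T
            · exact Or.inl ⟨hzT, hz⟩
            · exact Or.inr ⟨(hsub hz).1, (hsub hz).2, hzT⟩
        _ ≤ _ := by rw [h1, zero_add]; exact h2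
    have h4 := (hA1 u (by nlinarith)).trans h3
    rw [ENNReal.ofReal_le_ofReal_iff (by positivity)] at h4
    have h5 : (1 / 4 : ℝ) ^ m ≤ 1 / 4 := by
      calc (1 / 4 : ℝ) ^ m ≤ (1 / 4) ^ 1 := pow_le_pow_of_le_one (by norm_num) (by norm_num) h.hm
        _ = _ := by norm_num
    have : 0 < (l / 16) ^ m := by positivity
    nlinarith
  obtain ⟨y', hy'T, hy'⟩ := hne
  refine ⟨y', hy'T, (hsub hy').1, ?_⟩
  have h6 : dist y' (y + A u) ≤ l / 16 := hy'
  have h7 : dist (y + A u) y = ‖u‖ := by rw [dist_eq_norm, add_sub_cancel_left, A.norm_map]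
  have := dist_triangle y' (y + A u) y
  nlinarith

lemma chain (h : Ctx μ m J Lam L0 r1 T p x0) {t : Fin m → ℝ}
    (ht : t ∈ NN μ m J Lam L0 T p x0) (ht0 : dist (p x0) t ≤ L0 / 16) (k : ℕ) :
    ∃ y ∈ T, dist (p y) t ≤ (L0 / 2 ^ (k + 1)) / 8 ∧ dist y x0 ≤ 3 * J * L0 * (1 - 1 / 2 ^ k) := by
  have hJ : (1:ℝ) ≤ J := by exact_mod_cast h.hJ
  have hL0 := h.hL0
  induction k with
  | zero => exact ⟨x0, h.hx0, by norm_num; linarith, by norm_num⟩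
  | succ k ih =>
    obtain ⟨y, hy, h1, h2⟩ := ih
    have hk : (1:ℝ) ≤ 2 ^ k := one_le_pow₀ (by norm_num)
    have h3 : dist y x0 ≤ 8 * J * L0 := by
      have : (0:ℝ) ≤ 1 / 2 ^ k := by positivity
      have h4 : 0 < J * L0 := by positivity
      nlinarith
    obtain ⟨y', hy', h4, h5⟩ := h.step hy h3 (l := L0 / 2 ^ (k + 1)) (by positivity) (by
      rw [div_lt_iff₀ (by positivity), pow_succ]; nlinarith) ht h1
    refine ⟨y', hy', ?_, ?_⟩
    · rw [pow_succ 2 (k + 1)]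
      refine h4.trans_eq ?_
      field_simp; norm_num
    · have := dist_triangle y' y x0
      refine this.trans ((add_le_add h5 h2).trans_eq ?_)
      rw [pow_succ]; field_simp; ring

lemma fiber (h : Ctx μ m J Lam L0 r1 T p x0) {t : Fin m → ℝ}
    (ht : t ∈ NN μ m J Lam L0 T p x0) (ht0 : dist (p x0) t ≤ L0 / 16) {δ : ℝ} (hδ : 0 < δ) :
    ∃ r, 0 < r ∧ r ≤ δ ∧ ENNReal.ofReal (((1 / 2) ^ m - (1 / 4) ^ m) * r ^ m) ≤
      μ (p ⁻¹' closedBall t r ∩ (T ∩ closedBall x0 (8 * J * L0))) := by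
  have hJ : (1:ℝ) ≤ J := by exact_mod_cast h.hJ
  have hL0 := h.hL0
  obtain ⟨k, hk⟩ := exists_pow_lt_of_lt_one (show 0 < δ / L0 by positivity) (show (1/2:ℝ) < 1 by norm_num)
  obtain ⟨y, hy, h1, h2⟩ := h.chain ht ht0 k
  set l := L0 / 2 ^ (k + 1) with hldef
  have hl : 0 < l := by positivity
  have hkk : (1:ℝ) ≤ 2 ^ k := one_le_pow₀ (by norm_num)
  have hlL : l ≤ L0 / 2 := by
    rw [hldef, pow_succ, div_le_div_iff₀ (by positivity) (by norm_num)]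
    nlinarith
  have hlδ : l ≤ δ := by
    rw [lt_div_iff₀ hL0, one_div, inv_pow] at hk
    rw [hldef, pow_succ, div_le_iff₀ (by positivity)]
    have : L0 < δ * 2 ^ k := by
      rwa [inv_mul_lt_iff₀ (by positivity), mul_comm] at hk
    nlinarith
  refine ⟨l / 4, by positivity, by linarith, ?_⟩
  have hsub : closedBall y (l / 8) ⊆ p ⁻¹' closedBall t (l / 4) ∩ closedBall x0 (8 * J * L0) := by
    intro z hz
    have hz : dist z y ≤ l / 8 := hz
    constructor
    · have : dist (p z) (p y) ≤ l / 8 := by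
        rw [dist_eq_norm, ← map_sub]
        refine (h.hp _).trans ?_
        rwa [← dist_eq_norm]
      rw [mem_preimage, mem_closedBall]
      linarith [dist_triangle (p z) (p y) t]
    · rw [mem_closedBall]
      have := dist_triangle z y x0
      have h3 : (0:ℝ) ≤ 1 / 2 ^ k := by positivity
      have h4 : 0 < J * L0 := by positivity
      nlinarith
  have hlow := (h.reg y hy (l / 8) (by positivity) (by have := h.hr; nlinarith)).1
  have hτ := (ht (l / 4) (by positivity) (by linarith)).2
  have hsplit : μ (closedBall y (l / 8)) ≤
      μ (p ⁻¹' closedBall t (l / 4) ∩ (T ∩ closedBall x0 (8 * J * L0))) +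
      μ (p ⁻¹' closedBall t (l / 4) ∩ (closedBall x0 (16 * J * L0) \ toMeasurable μ T)) := by
    calc μ (closedBall y (l / 8)) ≤ μ (toMeasurable μ T ∩ closedBall y (l / 8)) +
          μ (p ⁻¹' closedBall t (l / 4) ∩ (closedBall x0 (16 * J * L0) \ toMeasurable μ T)) := by
          refine le_trans (measure_mono ?_) (measure_union_le _ _)
          intro z hz
          by_cases hzT : z ∈ toMeasurable μ T
          · exact Or.inl ⟨hzT, hz⟩
          · exact Or.inr ⟨(hsub hz).1, closedBall_subset_closedBall (by nlinarith) (hsub hz).2, hzT⟩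
      _ ≤ _ := by
          rw [Measure.measure_toMeasurable_inter measurableSet_closedBall (measure_ne_top _ _)]
          exact add_le_add (measure_mono
            fun z hz => ⟨(hsub hz.2).1, hz.1, (hsub hz.2).2⟩) le_rfl
  have h5 := hlow.trans (hsplit.trans (add_le_add_right hτ _))
  have e : (l / 8) ^ m = ((1 / 2) ^ m - (1 / 4) ^ m) * (l / 4) ^ m + (1 / 4) ^ m * (l / 4) ^ m := by
    rw [← add_mul, sub_add_cancel, ← mul_pow]; congr 1; ring
  have hq : (1 / 4 : ℝ) ^ m ≤ (1 / 2) ^ m := by gcongr; norm_num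
  rw [e, ENNReal.ofReal_add (mul_nonneg (by linarith) (by positivity)) (by positivity)] at h5
  exact (ENNReal.add_le_add_iff_right ENNReal.ofReal_ne_top).1 h5

lemma bilip (h : Ctx μ m J Lam L0 r1 T p x0) {y z : X} (hy : y ∈ T) (hz : z ∈ T)
    (hyx : dist y x0 ≤ 8 * J * L0) (hzx : dist z x0 ≤ 8 * J * L0)
    (ht : p y ∈ NN μ m J Lam L0 T p x0) : 1 / (32 * J) * dist y z ≤ dist (p y) (p z) := by
  have hJ : (1:ℝ) ≤ J := by exact_mod_cast h.hJ
  have hL0 := h.hL0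
  rcases (dist_nonneg (x := y) (y := z)).eq_or_lt with h0 | hd
  · rw [← h0, mul_zero]; exact dist_nonneg
  set d := dist y z with hdd
  have hd16 : d ≤ 16 * J * L0 := by
    have := dist_triangle_right y z x0
    nlinarith
  set l := d / (32 * J) with hl
  have hl0 : 0 < l := by positivity
  have hld : d = 32 * J * l := by rw [hl]; field_simp
  have hlL : l < L0 := by
    rw [hl, div_lt_iff₀ (by positivity)]; nlinarith
  obtain ⟨A, hA0, -, hA2⟩ := h.plane hy hyx hl0 hlL ht (by rw [dist_self]; positivity)
  have hlow := (h.reg z hz (l / 16) (by positivity) (by have := h.hr; nlinarith)).1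
  have hnot : ¬ closedBall z (l / 16) ⊆
      {z | z ∈ closedBall y (64 * J * l) ∧ ∀ u, l / 16 < dist z (y + A u)} := by
    intro hsub
    have h1 := hlow.trans ((measure_mono hsub).trans hA2)
    rw [ENNReal.ofReal_le_ofReal_iff (by positivity)] at h1
    have : (l / 32) ^ m < (l / 16) ^ m := by
      apply pow_lt_pow_left₀ (by linarith) (by positivity) h.hm.ne'
    linarith
  obtain ⟨w, hw, hw'⟩ := not_subset.1 hnot
  have hw : dist w z ≤ l / 16 := hw
  have hwy : w ∈ closedBall y (64 * J * l) := by
    rw [mem_closedBall]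
    have := dist_triangle w z y
    rw [dist_comm z y, ← hdd] at this
    nlinarith
  have hw'' : ∃ u, dist w (y + A u) ≤ l / 16 := by
    by_contra hc
    push Not at hc
    exact hw' ⟨hwy, hc⟩
  obtain ⟨u, hu⟩ := hw''
  have he : dist z (y + A u) ≤ l / 8 := by
    have := dist_triangle_left z (y + A u) w
    linarith
  have hun : d - l / 8 ≤ ‖u‖ := by
    have h1 := dist_triangle y (y + A u) z
    rw [dist_self_add_right, A.norm_map, dist_comm (y + A u) z, ← hdd] at h1
    linarith
  have h2 : dist (p (y + A u)) (p y) = ‖p (A u)‖ := by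
    rw [dist_eq_norm, ← map_sub, add_sub_cancel_left]
  have h3 : dist (p z) (p (y + A u)) ≤ l / 8 := by
    rw [dist_eq_norm, ← map_sub]
    refine (h.hp _).trans ?_
    rwa [← dist_eq_norm]
  have h4 := dist_triangle_left (p (y + A u)) (p y) (p z)
  rw [dist_comm (p z) (p y)] at h4
  have h5 := hA0 u
  have h6 : 1 / (16 * (J:ℝ)) * (d - l / 8) ≤ 1 / (16 * J) * ‖u‖ := by gcongr
  have h7 : 1 / (16 * (J:ℝ)) * (d - l / 8) = 2 * l - l / (128 * J) := by
    rw [hld]; field_simp; ring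
  have h8 : 1 / (32 * (J:ℝ)) * d = l := by rw [hld]; field_simp
  have h9 : l / (128 * J) ≤ l / 128 := by
    apply div_le_div_of_nonneg_left hl0.le (by norm_num); nlinarith
  rw [h8]
  linarith
end Ctx

lemma p_meas {m : ℕ} (p : X →ₗ[ℝ] (Fin m → ℝ)) : Measurable p :=
  p.continuous_of_finiteDimensional.measurable

lemma map_res {m : ℕ} (μ : Measure X) (p : X →ₗ[ℝ] (Fin m → ℝ)) (S : Set X) {W : Set (Fin m → ℝ)}
    (hW : MeasurableSet W) : ((μ.restrict S).map p) W = μ (p ⁻¹' W ∩ S) := by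
  rw [Measure.map_apply (p_meas p) hW, Measure.restrict_apply (p_meas p hW)]

lemma bad_le {m : ℕ} (σ : Measure (Fin m → ℝ)) {lam L0 C : ℝ} (hlam : 0 < lam) (hL0 : 0 < L0)
    (q : Fin m → ℝ) (hσ : σ (closedBall q (2 * L0)) ≤ ENNReal.ofReal C)
    (hC : 10 ^ m * C ≤ lam * (1 / 4 * (L0 / 8) ^ m)) :
    volume {t | t ∈ closedBall q (L0 / 16) ∧ ∃ l, 0 < l ∧ l < L0 ∧
      ENNReal.ofReal (lam * l ^ m) < σ (closedBall t l)} ≤ ENNReal.ofReal (1 / 4 * (L0 / 8) ^ m) := by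
  have h := vitali_est σ {t | t ∈ closedBall q (L0 / 16) ∧ ∃ l, 0 < l ∧ l < L0 ∧
      ENNReal.ofReal (lam * l ^ m) < σ (closedBall t l)} (closedBall q (2 * L0)) (L0 := L0) hlam (by
    rintro t ⟨ht, l, h1, h2, h3⟩
    refine ⟨l, h1, h2.le, h3.le, closedBall_subset_closedBall' ?_⟩
    have : dist t q ≤ L0 / 16 := ht
    linarith)
  have h2 : ENNReal.ofReal lam * volume {t | t ∈ closedBall q (L0 / 16) ∧ ∃ l, 0 < l ∧ l < L0 ∧
      ENNReal.ofReal (lam * l ^ m) < σ (closedBall t l)} ≤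
      ENNReal.ofReal lam * ENNReal.ofReal (1 / 4 * (L0 / 8) ^ m) := by
    refine h.trans ((mul_le_mul_right hσ _).trans ?_)
    rw [← ENNReal.ofReal_mul (by positivity), ← ENNReal.ofReal_mul hlam.le]
    exact ENNReal.ofReal_le_ofReal hC
  exact (ENNReal.mul_le_mul_iff_right (by simpa using hlam) ENNReal.ofReal_ne_top).1 h2

namespace Ctx
variable {μ : Measure X} [IsFiniteMeasure μ] {m J : ℕ} {Lam L0 r1 : ℝ} {T : Set X}
    {p : X →ₗ[ℝ] (Fin m → ℝ)} {x0 : X}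

lemma NN_closed : IsClosed (NN μ m J Lam L0 T p x0) := by
  have h1 := closed_good ((μ.restrict (closedBall x0 (16 * J * L0))).map p) Lam L0
  have h2 := closed_good ((μ.restrict (closedBall x0 (16 * J * L0) \ toMeasurable μ T)).map p)
    ((1 / 4) ^ m) L0
  have h3 := h1.inter h2
  convert h3 using 1
  ext t
  simp only [NN, mem_ofPred_eq, mem_inter_iff, map_res μ p _ measurableSet_closedBall]
  constructor
  · intro h; exact ⟨fun l a b => (h l a b).1, fun l a b => (h l a b).2⟩
  · intro h l a b; exact ⟨h.1 l a b, h.2 l a b⟩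

lemma NN_pos (h : Ctx μ m J Lam L0 r1 T p x0) {Cm : ℝ} (hLam : 0 < Lam)
    (hσ : μ (p ⁻¹' closedBall (p x0) (2 * L0) ∩ closedBall x0 (16 * J * L0)) ≤
      ENNReal.ofReal (Cm * L0 ^ m)) (hCm : 4 * 80 ^ m * Cm ≤ Lam) {C' : ℝ}
    (hτ : μ (closedBall x0 (16 * J * L0) \ toMeasurable μ T) ≤ ENNReal.ofReal C')
    (hC' : 4 * 80 ^ m * C' ≤ (1 / 4) ^ m * L0 ^ m) :
    volume (NN μ m J Lam L0 T p x0 ∩ closedBall (p x0) (L0 / 16)) ≠ 0 := by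
  intro h0
  have hL0 := h.hL0
  set σ := (μ.restrict (closedBall x0 (16 * J * L0))).map p with hσd
  set τ := (μ.restrict (closedBall x0 (16 * J * L0) \ toMeasurable μ T)).map p with hτd
  have e80 : ∀ a : ℝ, 10 ^ m * a = (4 * 80 ^ m * a) * (1 / 4 * (1 / 8) ^ m) := by
    intro a
    have : (80:ℝ) ^ m * (1 / 8) ^ m = 10 ^ m := by rw [← mul_pow]; norm_num
    rw [← this]; ring
  have e8 : (L0 / 8) ^ m = L0 ^ m * (1 / 8) ^ m := by rw [← mul_pow]; congr 1; ring
  have b1 := bad_le σ hLam hL0 (p x0) (C := Cm * L0 ^ m)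
    (by rw [hσd, map_res μ p _ measurableSet_closedBall]; exact hσ) (by
      rw [e80, e8]
      have : 0 ≤ L0 ^ m * (1 / 4 * (1 / 8) ^ m) := by positivity
      nlinarith)
  have b2 := bad_le τ (lam := (1 / 4) ^ m) (by positivity) hL0 (p x0) (C := C')
    (by rw [hτd, map_res μ p _ measurableSet_closedBall]
        exact (measure_mono inter_subset_right).trans hτ) (by
      rw [e80, e8]
      have : (0:ℝ) ≤ (1 / 4 * (1 / 8) ^ m) := by positivity
      nlinarith)
  have hcov : closedBall (p x0) (L0 / 16) ⊆ ((NN μ m J Lam L0 T p x0 ∩ closedBall (p x0) (L0 / 16)) ∪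
      {t | t ∈ closedBall (p x0) (L0 / 16) ∧ ∃ l, 0 < l ∧ l < L0 ∧
      ENNReal.ofReal (Lam * l ^ m) < σ (closedBall t l)}) ∪
      {t | t ∈ closedBall (p x0) (L0 / 16) ∧ ∃ l, 0 < l ∧ l < L0 ∧
      ENNReal.ofReal ((1 / 4) ^ m * l ^ m) < τ (closedBall t l)} := by
    intro t ht
    by_contra hc
    simp only [mem_union, mem_inter_iff, mem_ofPred_eq, not_or, not_and, not_exists, ht, true_implies,
      not_lt] at hc
    obtain ⟨⟨c1, c2⟩, c3⟩ := hc
    refine c1 (fun l h1 h2 => ⟨?_, ?_⟩) trivial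
    · have := c2 l h1 h2
      rwa [hσd, map_res μ p _ measurableSet_closedBall] at this
    · have := c3 l h1 h2
      rwa [hτd, map_res μ p _ measurableSet_closedBall] at this
  have hv := (measure_mono (μ := volume) hcov).trans ((measure_union_le _ _).trans
    (add_le_add ((measure_union_le _ _).trans (add_le_add h0.le b1)) b2))
  rw [Real.volume_pi_closedBall _ (by positivity), Fintype.card_fin, zero_add,
    ← ENNReal.ofReal_add (by positivity) (by positivity), ENNReal.ofReal_le_ofReal_iff (by positivity),
    show 2 * (L0 / 16) = L0 / 8 by ring] at hv
  have : 0 < (L0 / 8) ^ m := by positivity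
  linarith

lemma G_pos (h : Ctx μ m J Lam L0 r1 T p x0)
    (hN : volume (NN μ m J Lam L0 T p x0 ∩ closedBall (p x0) (L0 / 16)) ≠ 0) :
    μ (p ⁻¹' (NN μ m J Lam L0 T p x0 ∩ closedBall (p x0) (L0 / 16)) ∩
      (T ∩ closedBall x0 (8 * J * L0))) ≠ 0 := by
  intro h0
  set N := NN μ m J Lam L0 T p x0 ∩ closedBall (p x0) (L0 / 16) with hNd
  have hNm : MeasurableSet N := (NN_closed.inter isClosed_closedBall).measurableSet
  set σ := (μ.restrict (T ∩ closedBall x0 (8 * J * L0))).map p with hσ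
  have hσ0 : σ N = 0 := by rw [hσ, map_res μ p _ hNm]; exact h0
  have hlam : (0:ℝ) < (1 / 2) ^ m - (1 / 4) ^ m := by
    have : (1 / 4 : ℝ) ^ m < (1 / 2) ^ m := pow_lt_pow_left₀ (by norm_num) (by norm_num) h.hm.ne'
    linarith
  set a := ENNReal.ofReal ((1 / 2) ^ m - (1 / 4) ^ m) * volume N with ha
  have ha0 : a ≠ 0 := mul_ne_zero (by simpa using hlam) hN
  have h10 : ENNReal.ofReal ((10:ℝ) ^ m) ≠ 0 := by
    rw [Ne, ENNReal.ofReal_eq_zero, not_le]; positivity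
  obtain ⟨O, hNO, hO, hlt⟩ := Set.exists_isOpen_lt_of_lt (μ := σ) N (a / ENNReal.ofReal (10 ^ m)) (by
    rw [hσ0]; exact ENNReal.div_pos ha0 ENNReal.ofReal_ne_top)
  have hv := vitali_est σ N O (L0 := 1) hlam (by
    intro t ht
    obtain ⟨e, he, hball⟩ := Metric.isOpen_iff.1 hO t (hNO ht)
    obtain ⟨r, hr0, hr1, hr2⟩ := h.fiber ht.1 (by rw [dist_comm]; exact ht.2)
      (δ := min 1 (e / 2)) (by positivity)
    refine ⟨r, hr0, hr1.trans (min_le_left _ _), ?_, (closedBall_subset_ball ?_).trans hball⟩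
    · rw [hσ, map_res μ p _ measurableSet_closedBall]; exact hr2
    · have := hr1.trans (min_le_right _ _); linarith)
  rw [ENNReal.lt_div_iff_mul_lt (Or.inl h10) (Or.inl ENNReal.ofReal_ne_top), mul_comm] at hlt
  exact absurd hv (not_le.2 hlt)
end Ctx

lemma eucl_norm_le {m : ℕ} (hm : 0 < m) (u : EuclideanSpace ℝ (Fin m)) {M : ℝ} (hM : 0 ≤ M)
    (h : ∀ i, |u i| ≤ M) : ‖u‖ ≤ m * M := by
  apply abs_le_of_sq_le_sq' _ (by positivity) |>.2
  rw [EuclideanSpace.norm_sq_eq]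
  calc ∑ i, ‖u i‖ ^ 2 ≤ ∑ _i : Fin m, M ^ 2 := by
        gcongr with i
        exact h i
    _ = m * M ^ 2 := by simp
    _ ≤ (m * M) ^ 2 := by
        have : (1:ℝ) ≤ m := by exact_mod_cast hm
        nlinarith [sq_nonneg M, mul_nonneg (sub_nonneg.2 this) (sq_nonneg M), mul_nonneg (by linarith : (0:ℝ) ≤ m) (mul_nonneg (sub_nonneg.2 this) (sq_nonneg M))]

lemma exists_density (μ : Measure X) [IsFiniteMeasure μ] {T : Set X} (hT : μ T ≠ 0) :
    ∃ x ∈ T, Tendsto (fun r => μ (T ∩ closedBall x r) / μ (closedBall x r)) (𝓝[>] 0) (𝓝 1) := by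
  have := Besicovitch.ae_tendsto_measure_inter_div μ T
  have h3 := Measure.measure_inter_eq_zero_of_restrict (ae_iff.1 this)
  by_contra hc
  push Not at hc
  apply hT
  refine measure_mono_null ?_ h3
  intro x hx
  exact ⟨hc x hx, hx⟩

theorem piece (μ : Measure X) [IsFiniteMeasure μ] {m : ℕ} (hm : 0 < m) :
    ∃ κ > 0, ∃ κ2 > 0, ∀ r1 > 0, ∀ T : Set X, Reg μ m κ κ2 r1 T → μ T ≠ 0 →
      ∃ p : X →ₗ[ℝ] (Fin m → ℝ), ∃ c > 0, ∃ G ⊆ T, μ G ≠ 0 ∧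
        ∀ y ∈ G, ∀ z ∈ G, c * dist y z ≤ dist (p y) (p z) := by
  set Cm : ℝ := 1 + (4 * (3 * m + 1)) ^ m with hCm
  have hCm0 : 0 < Cm := by positivity
  set Lam : ℝ := 4 * 80 ^ m * Cm with hLam
  have hLam0 : 0 < Lam := by positivity
  obtain ⟨J, hJ⟩ := exists_nat_gt (2 * Lam * 16 ^ m)
  have hJ0' : (0:ℝ) < J := lt_trans (by positivity) hJ
  have hJ0 : 0 < J := by exact_mod_cast hJ0'
  have hJ1 : (1:ℝ) ≤ J := by exact_mod_cast hJ0
  refine ⟨1 / (1024 * J), by positivity, (1 / (2048 * J)) ^ m, by positivity, ?_⟩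
  intro r1 hr1 T hReg hT
  obtain ⟨x0, hx0, hdens⟩ := exists_density μ hT
  set ε : ℝ := (1 / 4) ^ m / (4 * 80 ^ m * (64 * J) ^ m) with hε
  have hε0 : 0 < ε := by positivity
  have hε1 : ε ≤ 1 := by
    rw [hε, div_le_one (by positivity)]
    have a1 : (1 / 4 : ℝ) ^ m ≤ 1 := pow_le_one₀ (by norm_num) (by norm_num)
    have a2 : (1:ℝ) ≤ 80 ^ m := one_le_pow₀ (by norm_num)
    have a3 : (1:ℝ) ≤ (64 * J) ^ m := one_le_pow₀ (by nlinarith)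
    nlinarith
  have hev : ∀ᶠ r in 𝓝[>] (0:ℝ), ENNReal.ofReal (1 - ε) <
      μ (T ∩ closedBall x0 r) / μ (closedBall x0 r) :=
    hdens.eventually (Ioi_mem_nhds (by rw [ENNReal.ofReal_lt_one]; linarith))
  obtain ⟨δ, hδ, hev⟩ := mem_nhdsGT_iff_exists_Ioo_subset.1 hev
  have hδ : 0 < δ := hδ
  set M : ℝ := 64 * J + 3 * m + 2 with hM
  have hM0 : 0 < M := by positivity
  set L0 : ℝ := min r1 δ / (2 * M) with hL0d
  have hL0 : 0 < L0 := by positivity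
  have hML : 2 * M * L0 = min r1 δ := by rw [hL0d]; field_simp
  have hmL : 0 ≤ (m:ℝ) * L0 := by positivity
  have hJL : 0 < (J:ℝ) * L0 := by positivity
  have k1 : 64 * J * L0 < r1 := by
    have := min_le_left r1 δ
    nlinarith
  have k2 : (3 * m + 1) * L0 < r1 := by
    have := min_le_left r1 δ
    nlinarith
  have k3 : 16 * J * L0 < δ := by
    have := min_le_right r1 δ
    nlinarith
  -- the plane and the projection
  obtain ⟨A, hA1, hA2⟩ := (hReg x0 hx0 (64 * J * L0) (by positivity) k1).2.2
  have e1 : 1 / (1024 * (J:ℝ)) * (64 * J * L0) = L0 / 16 := by field_simp; norm_num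
  have e2 : (1 / (2048 * (J:ℝ))) ^ m * (64 * J * L0) ^ m = (L0 / 32) ^ m := by
    rw [← mul_pow]; congr 1; field_simp; norm_num
  rw [e1, e2] at hA2
  let p : X →ₗ[ℝ] (Fin m → ℝ) := LinearMap.pi fun i => innerₗ X (A (EuclideanSpace.single i 1))
  have hpi : ∀ z i, p z i = inner ℝ (A (EuclideanSpace.single i 1)) z := fun z i => rfl
  have hp : ∀ z, ‖p z‖ ≤ ‖z‖ := by
    intro z
    rw [pi_norm_le_iff_of_nonneg (norm_nonneg _)]
    intro i
    rw [hpi]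
    refine (norm_inner_le_norm _ _).trans ?_
    rw [A.norm_map]; simp
  have hpA : ∀ u i, p (A u) i = u i := by
    intro u i
    rw [hpi, A.inner_map_map, EuclideanSpace.inner_single_left]; simp
  have ctx : Ctx μ m J Lam L0 r1 T p x0 :=
    { hm := hm
      hJ := hJ0
      hLam := hLam0.le
      hJL := by
        rw [one_div_pow, show (J:ℝ) * (1 / 2 * (1 / 16 ^ m)) = J / (2 * 16 ^ m) by field_simp,
          lt_div_iff₀ (by positivity)]
        linarith
      hp := hp
      hL0 := hL0
      hr := k1
      hx0 := hx0
      reg := hReg }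
  have hσ : μ (p ⁻¹' closedBall (p x0) (2 * L0) ∩ closedBall x0 (16 * J * L0)) ≤
      ENNReal.ofReal (Cm * L0 ^ m) := by
    have hsub : p ⁻¹' closedBall (p x0) (2 * L0) ∩ closedBall x0 (16 * J * L0) ⊆
        {z | z ∈ closedBall x0 (64 * J * L0) ∧ ∀ u, L0 / 16 < dist z (x0 + A u)} ∪
        closedBall x0 ((3 * m + 1) * L0) := by
      rintro z ⟨hz1, hz2⟩
      by_cases hz3 : ∀ u, L0 / 16 < dist z (x0 + A u)
      · left
        exact ⟨closedBall_subset_closedBall (by nlinarith) hz2, hz3⟩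
      · right
        push Not at hz3
        obtain ⟨u, hu⟩ := hz3
        have hz1 : dist (p z) (p x0) ≤ 2 * L0 := hz1
        have q1 : dist (p (x0 + A u)) (p z) ≤ L0 / 16 := by
          rw [dist_comm, dist_eq_norm, ← map_sub]
          refine (hp _).trans ?_
          rwa [← dist_eq_norm]
        have q2 : ‖p (A u)‖ ≤ 3 * L0 := by
          have q3 : ‖p (A u)‖ = dist (p (x0 + A u)) (p x0) := by
            rw [dist_eq_norm, ← map_sub, add_sub_cancel_left]
          rw [q3]
          linarith [dist_triangle (p (x0 + A u)) (p z) (p x0)]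
        have q4 : ‖u‖ ≤ m * (3 * L0) := by
          apply eucl_norm_le hm u (by positivity)
          intro i
          rw [← hpA, ← Real.norm_eq_abs]
          exact (norm_le_pi_norm _ i).trans q2
        rw [mem_closedBall]
        have q5 := dist_triangle z (x0 + A u) x0
        have q6 : dist (x0 + A u) x0 = ‖u‖ := by rw [dist_eq_norm, add_sub_cancel_left, A.norm_map]
        rw [q6] at q5
        linarith
    refine (measure_mono hsub).trans ((measure_union_le _ _).trans
      ((add_le_add hA2 (hReg x0 hx0 _ (by positivity) k2).2.1).trans ?_))
    rw [← ENNReal.ofReal_add (by positivity) (by positivity)]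
    apply ENNReal.ofReal_le_ofReal
    have hR : Cm * L0 ^ m = L0 ^ m + (4 * ((3 * (m:ℝ) + 1) * L0)) ^ m := by
      rw [hCm, ← mul_assoc 4, mul_pow (4 * (3 * (m:ℝ) + 1)) L0]; ring
    rw [hR]
    gcongr
    linarith
  have hτ : μ (closedBall x0 (16 * J * L0) \ toMeasurable μ T) ≤
      ENNReal.ofReal (ε * (4 * (16 * J * L0)) ^ m) := by
    have hB := (hReg x0 hx0 (16 * J * L0) (by positivity) (by nlinarith)).2.1
    have hB0 := (hReg x0 hx0 (16 * J * L0) (by positivity) (by nlinarith)).1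
    set B := closedBall x0 (16 * J * L0) with hBd
    have hB0' : μ B ≠ 0 := by
      refine (lt_of_lt_of_le ?_ hB0).ne'
      rw [ENNReal.ofReal_pos]; positivity
    have d1 : ENNReal.ofReal (1 - ε) < μ (T ∩ B) / μ B :=
      hev (show 16 * J * L0 ∈ Ioo 0 δ from ⟨by positivity, k3⟩)
    rw [ENNReal.lt_div_iff_mul_lt (Or.inl hB0') (Or.inl (measure_ne_top _ _))] at d1
    rw [← Measure.measure_toMeasurable_inter measurableSet_closedBall (measure_ne_top μ T)] at d1
    have d2 := measure_inter_add_sdiff (μ := μ) B (measurableSet_toMeasurable μ T)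
    rw [inter_comm] at d1
    have d3 : ENNReal.ofReal (1 - ε) * μ B + μ (B \ toMeasurable μ T) ≤
        ENNReal.ofReal (1 - ε) * μ B + ENNReal.ofReal ε * μ B := by
      rw [← add_mul, ← ENNReal.ofReal_add (by linarith) hε0.le, sub_add_cancel, ENNReal.ofReal_one, one_mul]
      calc _ ≤ μ (B ∩ toMeasurable μ T) + μ (B \ toMeasurable μ T) := add_le_add d1.le le_rfl
        _ = _ := d2
    have d4 := (ENNReal.add_le_add_iff_left (ENNReal.mul_ne_top ENNReal.ofReal_ne_top
      (measure_ne_top _ _))).1 d3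
    refine d4.trans ?_
    rw [ENNReal.ofReal_mul hε0.le]
    gcongr
  have hN := ctx.NN_pos hLam0 hσ hLam.ge hτ (by
    rw [show 4 * (16 * (J:ℝ) * L0) = (64 * J) * L0 by ring, mul_pow (64 * (J:ℝ)), hε]
    apply le_of_eq
    field_simp)
  refine ⟨p, 1 / (32 * J), by positivity, _, ?_, ctx.G_pos hN, ?_⟩
  · exact fun z hz => hz.2.1
  · intro y hy z hz
    exact ctx.bilip hy.2.1 hz.2.1 hy.2.2 hz.2.2 hy.1.1

/-- A closed set on which some linear map to `ℝᵐ` is bi-Lipschitz. -/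
def Piece (m : ℕ) (G : Set X) : Prop :=
  IsClosed G ∧ ∃ p : X →ₗ[ℝ] (Fin m → ℝ), ∃ c > 0, ∀ y ∈ G, ∀ z ∈ G,
    c * dist y z ≤ dist (p y) (p z)

lemma piece_empty (m : ℕ) : Piece m (∅ : Set X) :=
  ⟨isClosed_empty, 0, 1, one_pos, by simp⟩

lemma piece_closure {m : ℕ} {G : Set X} (p : X →ₗ[ℝ] (Fin m → ℝ)) {c : ℝ} (hc : 0 < c)
    (h : ∀ y ∈ G, ∀ z ∈ G, c * dist y z ≤ dist (p y) (p z)) : Piece m (closure G) := by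
  refine ⟨isClosed_closure, p, c, hc, ?_⟩
  have hp := p.continuous_of_finiteDimensional
  have hcl : IsClosed {q : X × X | c * dist q.1 q.2 ≤ dist (p q.1) (p q.2)} :=
    isClosed_le (by fun_prop) (by fun_prop)
  have hsub : closure (G ×ˢ G) ⊆ {q : X × X | c * dist q.1 q.2 ≤ dist (p q.1) (p q.2)} := by
    refine closure_minimal ?_ hcl
    rintro ⟨y, z⟩ ⟨hy, hz⟩
    exact h y hy z hz
  rw [closure_prod_eq] at hsub
  intro y hy z hz
  exact hsub (show (y, z) ∈ closure G ×ˢ closure G from ⟨hy, hz⟩)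

lemma exhaust (μ : Measure X) [IsFiniteMeasure μ] (P : Set X → Prop) (h0 : P ∅)
    (hm : ∀ G, P G → MeasurableSet G)
    (hex : ∀ Z, MeasurableSet Z → μ Z ≠ 0 → ∃ G ⊆ Z, μ G ≠ 0 ∧ ∃ G', G ⊆ G' ∧ P G') :
    ∃ G : ℕ → Set X, (∀ i, P (G i)) ∧ μ (⋃ i, G i)ᶜ = 0 := by
  let S : Set ℝ≥0∞ := {t | ∃ G : ℕ → Set X, (∀ i, P (G i)) ∧ t = μ (⋃ i, G i)}
  have hS : S.Nonempty := ⟨_, fun _ => ∅, fun _ => h0, rfl⟩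
  obtain ⟨u, -, hu, huS⟩ := exists_seq_tendsto_sSup hS (OrderTop.bddAbove S)
  choose G hG hGu using huS
  let H : ℕ → Set X := fun k => G (Nat.unpair k).1 (Nat.unpair k).2
  have hH : ∀ k, P (H k) := fun k => hG _ _
  have hHs : sSup S ≤ μ (⋃ k, H k) := by
    refine le_of_tendsto' hu fun i => ?_
    rw [hGu]
    refine measure_mono (iUnion_subset fun j => ?_)
    intro x hx
    refine mem_iUnion.2 ⟨Nat.pair i j, ?_⟩
    simpa [H] using hx
  have hHm : MeasurableSet (⋃ k, H k) := MeasurableSet.iUnion fun k => hm _ (hH k)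
  refine ⟨H, hH, ?_⟩
  by_contra hne
  obtain ⟨F, hF, hF0, F', hFF, hF'⟩ := hex _ hHm.compl hne
  let H' : ℕ → Set X := fun k => Nat.casesOn k F' H
  have hH' : ∀ k, P (H' k) := by
    intro k
    cases k with
    | zero => exact hF'
    | succ k => exact hH k
  have h1 : μ (⋃ k, H' k) ≤ sSup S := le_sSup ⟨H', hH', rfl⟩
  have h2 : F ∪ (⋃ k, H k) ⊆ ⋃ k, H' k := by
    refine union_subset ?_ (iUnion_subset fun k => ?_)
    · exact hFF.trans (subset_iUnion H' 0)
    · exact subset_iUnion H' (k + 1)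
  have h3 : μ (F ∪ ⋃ k, H k) = μ F + μ (⋃ k, H k) :=
    measure_union (disjoint_left.2 fun x hx => hF hx) hHm
  have h4 : μ F + μ (⋃ k, H k) ≤ 0 + μ (⋃ k, H k) := by
    rw [← h3, zero_add]
    exact (measure_mono h2).trans (h1.trans hHs)
  have h5 := (ENNReal.add_le_add_iff_right (measure_ne_top μ _)).1 h4
  exact hF0 (le_antisymm h5 bot_le)

lemma cover (μ : Measure X) [IsFiniteMeasure μ] {m : ℕ} (hm : 0 < m)
    (hg : ∀ᵐ x ∂μ, Good μ (m : ℝ) x) :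
    ∃ G : ℕ → Set X, (∀ i, Piece m (G i)) ∧ μ (⋃ i, G i)ᶜ = 0 := by
  obtain ⟨κ, hκ, κ2, hκ2, hpiece⟩ := piece μ hm
  refine exhaust μ (Piece m) (piece_empty m) (fun G hG => hG.1.measurableSet) ?_
  intro Z hZ hZ0
  let T : ℕ → Set X := fun k => {x | Reg μ m κ κ2 (1 / ((k:ℝ) + 1)) {x}}
  have hT : ∀ᵐ x ∂μ, x ∈ ⋃ k, T k := by
    filter_upwards [hg] with x hx
    obtain ⟨ρ, hρ, hR⟩ := good_reg μ hm hx hκ hκ2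
    obtain ⟨k, hk⟩ := exists_nat_one_div_lt hρ
    exact mem_iUnion.2 ⟨k, fun y hy s hs hs' => hR y hy s hs (hs'.trans hk)⟩
  have : ∃ k, μ (Z ∩ T k) ≠ 0 := by
    by_contra hcon
    push Not at hcon
    apply hZ0
    have h1 : μ (⋃ k, Z ∩ T k) = 0 := measure_iUnion_null hcon
    rw [← inter_iUnion] at h1
    have h2 : μ (⋃ k, T k)ᶜ = 0 := hT
    refine measure_mono_null ?_ (measure_union_null h1 h2)
    intro x hx
    by_cases hxT : x ∈ ⋃ k, T k
    · exact Or.inl ⟨hx, hxT⟩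
    · exact Or.inr hxT
  obtain ⟨k, hk⟩ := this
  obtain ⟨p, c, hc, G, hGT, hG0, hG⟩ := hpiece (1 / ((k:ℝ) + 1)) (by positivity) (Z ∩ T k)
    (fun y hy s hs hs' => hy.2 y rfl s hs hs') hk
  exact ⟨G, hGT.trans inter_subset_left, hG0, closure G, subset_closure, piece_closure p hc hG⟩

lemma piece_lip {m : ℕ} {G : Set X} (hG : Piece m G) :
    ∃ (f : EuclideanSpace ℝ (Fin m) → X) (A : Set (EuclideanSpace ℝ (Fin m))) (K : ℝ≥0),
      LipschitzOnWith K f A ∧ G ⊆ f '' A := by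
  obtain ⟨-, p, c, hc, h⟩ := hG
  let q : X → EuclideanSpace ℝ (Fin m) := fun x => WithLp.toLp 2 (p x)
  have hq : ∀ y ∈ G, ∀ z ∈ G, c * dist y z ≤ dist (q y) (q z) := by
    intro y hy z hz
    refine (h y hy z hz).trans ?_
    refine (dist_pi_le_iff dist_nonneg).2 fun i => ?_
    have := PiLp.norm_apply_le (q y - q z) i
    rw [dist_eq_norm, dist_eq_norm]
    exact this
  have hinj : InjOn q G := by
    intro y hy z hz hyz
    have := hq y hy z hz
    rw [hyz, dist_self] at this
    have h2 : dist y z ≤ 0 := by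
      by_contra hcon
      push Not at hcon
      nlinarith [mul_pos hc hcon]
    exact dist_le_zero.1 h2
  refine ⟨Function.invFunOn q G, q '' G, Real.toNNReal c⁻¹, ?_, ?_⟩
  · refine LipschitzOnWith.of_dist_le_mul ?_
    rintro _ ⟨y, hy, rfl⟩ _ ⟨z, hz, rfl⟩
    rw [hinj.leftInvOn_invFunOn hy, hinj.leftInvOn_invFunOn hz]
    rw [Real.coe_toNNReal _ (by positivity), ← div_eq_inv_mul, le_div_iff₀ hc, mul_comm]
    exact hq y hy z hz
  · intro y hy
    exact ⟨q y, ⟨y, hy, rfl⟩, hinj.leftInvOn_invFunOn hy⟩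

theorem main_pos {α : ℝ} (hα : 0 < α) (E : Set X)
    (h0 : 0 < μH[α] E) (hfin : μH[α] E < ⊤)
    (hdens : ∀ᵐ x ∂((μH[α] : Measure X).restrict E),
      Tendsto
        (fun r : ℝ => μH[α] (E ∩ Metric.closedBall x r) / ENNReal.ofReal (2 * r) ^ α)
        (nhdsWithin 0 (Set.Ioi 0)) (nhds 1)) :
    ∃ m : ℕ, α = m ∧
      ∃ (f : ℕ → EuclideanSpace ℝ (Fin m) → X)
        (A : ℕ → Set (EuclideanSpace ℝ (Fin m))) (K : ℕ → ℝ≥0),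
        (∀ i, LipschitzOnWith (K i) (f i) (A i)) ∧
        μH[(m : ℝ)] (E \ ⋃ i, f i '' A i) = 0 := by
  have hres : (μH[α] : Measure X).restrict (toMeasurable μH[α] E) = μH[α].restrict E :=
    Measure.restrict_toMeasurable hfin.ne
  have hgood := ae_good (α := α) (E := toMeasurable (μH[α] : Measure X) E) hα
    (measurableSet_toMeasurable _ _) (by rw [measure_toMeasurable]; exact hfin.ne) (by
      rw [hres]
      filter_upwards [hdens] with x hx
      refine hx.congr fun r => ?_
      rw [Measure.restrict_apply measurableSet_closedBall, inter_comm])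
  rw [hres] at hgood
  set μ := (μH[α] : Measure X).restrict E with hμ
  haveI : IsFiniteMeasure μ := ⟨by rw [hμ, Measure.restrict_apply_univ]; exact hfin⟩
  have hμ0 : μ ≠ 0 := by
    intro h
    rw [hμ, Measure.restrict_eq_zero] at h
    exact h0.ne' h
  haveI : NeBot (ae μ) := ae_neBot.2 hμ0
  obtain ⟨x, hx⟩ := hgood.exists
  obtain ⟨m, rfl⟩ := good_nat μ hα hx
  have hm : 0 < m := by exact_mod_cast hα
  obtain ⟨G, hG, hG0⟩ := cover μ hm hgood
  choose f A K hK hGA using fun i => piece_lip (hG i)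
  refine ⟨m, rfl, f, A, K, hK, ?_⟩
  have hmeas : MeasurableSet (⋃ i, G i)ᶜ :=
    (MeasurableSet.iUnion fun i => (hG i).1.measurableSet).compl
  rw [hμ, Measure.restrict_apply hmeas] at hG0
  refine measure_mono_null ?_ hG0
  rintro y ⟨hy, hy'⟩
  exact ⟨fun hyG => hy' (iUnion_mono hGA hyG), hy⟩

theorem main_zero (E : Set X) (hfin : μH[(0:ℝ)] E < ⊤) :
    ∃ (f : ℕ → EuclideanSpace ℝ (Fin 0) → X)
        (A : ℕ → Set (EuclideanSpace ℝ (Fin 0))) (K : ℕ → ℝ≥0),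
        (∀ i, LipschitzOnWith (K i) (f i) (A i)) ∧
        μH[((0:ℕ) : ℝ)] (E \ ⋃ i, f i '' A i) = 0 := by
  have hEf : E.Finite := by
    by_contra hinf
    have h1 : ∀ k : ℕ, (k : ℝ≥0∞) ≤ μH[(0:ℝ)] E := by
      intro k
      obtain ⟨t, htE, htk⟩ := Set.Infinite.exists_subset_card_eq hinf k
      refine le_trans ?_ (measure_mono htE)
      rw [← sum_measure_singleton]
      simp [htk]
    obtain ⟨k, hk⟩ := ENNReal.exists_nat_gt hfin.ne
    exact absurd (h1 k) (not_le.2 hk)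
  rcases E.eq_empty_or_nonempty with rfl | hne
  · exact ⟨fun _ _ => 0, fun _ => ∅, fun _ => 0, by simp, by simp⟩
  · obtain ⟨e, he⟩ := hEf.countable.exists_eq_range hne
    refine ⟨fun i _ => e i, fun _ => univ, fun _ => 0, fun i => ?_, ?_⟩
    · exact (LipschitzWith.const (e i)).lipschitzOnWith
    · convert measure_empty (μ := (μH[((0:ℕ) : ℝ)] : Measure X))
      rw [sdiff_eq_empty, he]
      rintro _ ⟨i, rfl⟩
      exact mem_iUnion.2 ⟨i, 0, mem_univ _, rfl⟩

end Dens

/-- **Mattila's theorem.** If `E ⊆ ℝⁿ` (Euclidean) satisfies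
`0 < ℋᵅ(E) < ∞` and the `α`-density of `E` equals `1` at `ℋᵅ`-a.e. point of `E`,
then `α` is a natural number `m` and `E` is `m`-rectifiable: up to an `ℋᵐ`-null set,
`E` is covered by countably many Lipschitz images of subsets of `ℝᵐ`. -/
theorem statement_0 (n : ℕ) (α : ℝ) (hα : 0 ≤ α)
    (E : Set (EuclideanSpace ℝ (Fin n)))
    (h0 : 0 < μH[α] E) (hfin : μH[α] E < ⊤)
    (hdens : ∀ᵐ x ∂((μH[α] : Measure (EuclideanSpace ℝ (Fin n))).restrict E),
      Tendsto
        (fun r : ℝ => μH[α] (E ∩ Metric.closedBall x r) / ENNReal.ofReal (2 * r) ^ α)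
        (nhdsWithin 0 (Set.Ioi 0)) (nhds 1)) :
    ∃ m : ℕ, α = m ∧
      ∃ (f : ℕ → EuclideanSpace ℝ (Fin m) → EuclideanSpace ℝ (Fin n))
        (A : ℕ → Set (EuclideanSpace ℝ (Fin m))) (K : ℕ → ℝ≥0),
        (∀ i, LipschitzOnWith (K i) (f i) (A i)) ∧
        μH[(m : ℝ)] (E \ ⋃ i, f i '' A i) = 0 := by
  rcases hα.eq_or_lt with h | h
  · subst h
    exact ⟨0, by simp, Dens.main_zero E hfin⟩
  · exact Dens.main_pos h E h0 hfin hdens
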